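/- Fix ε > 0, a smooth compactly supported ū₁ : ℝ → ℝ and a smooth b : ℝ → ℝ with b, b′ of at most polynomial growth. Let V ∈ C¹([0,T]; 𝒮(ℝ²;ℝ³)) (Schwartz-valued) solve the linear system ε²∂ₜV + A(x₂,εD)V = 0 on [0,T] × ℝ². Then for all t ∈ [0,T], ‖V(t)‖_{L²(ℝ²;ℝ³)} ≤ e^{‖ū₁′‖_{L^∞} t} ‖V(0)‖_{L²(ℝ²;ℝ³)}. The bound is independent of ε. -/

import Mathlib

open MeasureTheory

noncomputable section

/-- partial derivative in the first variable -/
def pd1 {E : Type*} [NormedAddCommGroup E] [NormedSpace ℝ E]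
    (f : ℝ × ℝ → E) : ℝ × ℝ → E := fun x => fderiv ℝ f x (1, 0)

/-- partial derivative in the second variable -/
def pd2 {E : Type*} [NormedAddCommGroup E] [NormedSpace ℝ E]
    (f : ℝ × ℝ → E) : ℝ × ℝ → E := fun x => fderiv ℝ f x (0, 1)

/-- the linear propagator `A(x₂, εD)` acting on `U = (u₀,u₁,u₂)` -/
def Aop (ε : ℝ) (ub b : ℝ → ℝ) (U : Fin 3 → ℝ × ℝ → ℝ) : Fin 3 → ℝ × ℝ → ℝ :=
  ![fun x => ε^2 * ub x.2 * pd1 (U 0) x + ε * pd1 (U 1) x + ε * pd2 (U 2) x,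
    fun x => ε * pd1 (U 0) x + ε^2 * ub x.2 * pd1 (U 1) x
      + (-(b x.2) + ε^2 * deriv ub x.2) * U 2 x,
    fun x => ε * pd2 (U 0) x + b x.2 * U 1 x + ε^2 * ub x.2 * pd1 (U 2) x]

/-- L² norm of an ℝ³-valued function on ℝ² -/
def L2normV (F : Fin 3 → ℝ × ℝ → ℝ) : ℝ := Real.sqrt (∫ x : ℝ × ℝ, ∑ j, (F j x)^2)

section helpers

open Filter Topology Set

/-- Fatou for real integrals. -/
lemma fatou_real {f : ℕ → ℝ × ℝ → ℝ} {g : ℝ × ℝ → ℝ} {c : ℝ}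
    (hf0 : ∀ n x, 0 ≤ f n x) (hfi : ∀ n, Integrable (f n))
    (hlim : ∀ x, Tendsto (fun n => f n x) atTop (𝓝 (g x)))
    (hc : ∀ n, ∫ x, f n x ≤ c) : Integrable g ∧ ∫ x, g x ≤ c := by
  have hg0 : ∀ x, 0 ≤ g x := fun x => ge_of_tendsto' (hlim x) (fun n => hf0 n x)
  have hgm : AEStronglyMeasurable g volume :=
    aestronglyMeasurable_of_tendsto_ae atTop (fun n => (hfi n).aestronglyMeasurable)
      (Eventually.of_forall hlim)
  have hc0 : 0 ≤ c := (integral_nonneg (hf0 0)).trans (hc 0)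
  have key : ∫⁻ x, ENNReal.ofReal (g x) ≤ ENNReal.ofReal c := by
    have h1 : ∀ x, ENNReal.ofReal (g x) = liminf (fun n => ENNReal.ofReal (f n x)) atTop := by
      intro x
      exact ((ENNReal.continuous_ofReal.tendsto _).comp (hlim x)).liminf_eq.symm
    simp_rw [h1]
    refine (lintegral_liminf_le' (fun n => (hfi n).aemeasurable.ennreal_ofReal)).trans ?_
    refine liminf_le_of_le (by isBoundedDefault) ?_
    intro b hb
    obtain ⟨n, hn⟩ := hb.exists
    refine hn.trans ?_
    rw [← ofReal_integral_eq_lintegral_ofReal (hfi n) (Eventually.of_forall (hf0 n))]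
    exact ENNReal.ofReal_le_ofReal (hc n)
  have hgi : Integrable g := by
    refine ⟨hgm, ?_⟩
    rw [hasFiniteIntegral_iff_ofReal (Eventually.of_forall hg0)]
    exact key.trans_lt ENNReal.ofReal_lt_top
  refine ⟨hgi, ?_⟩
  rw [← ofReal_integral_eq_lintegral_ofReal hgi (Eventually.of_forall hg0)] at key
  exact (ENNReal.ofReal_le_ofReal_iff hc0).1 key

/-- Fundamental theorem of calculus for integrals, with integral bounds only. -/
lemma ftc_integral {g g' : ℝ → ℝ × ℝ → ℝ} {s t M κ : ℝ} (hst : s ≤ t)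
    (hg : ∀ τ x, HasDerivAt (fun τ => g τ x) (g' τ x) τ)
    (hgm : ∀ τ, Measurable (g τ))
    (hgs : Integrable (g s)) (hgt : Integrable (g t))
    (hgi : ∀ τ ∈ Icc s t, Integrable (g' τ))
    (hgM : ∀ τ ∈ Icc s t, ∫ x, |g' τ x| ≤ M)
    (hκ : ∀ τ ∈ Icc s t, ∫ x, g' τ x ≤ κ) :
    ∫ x, g t x ≤ (∫ x, g s x) + κ * (t - s) := by
  have hm : Measurable (Function.uncurry g) :=
    measurable_uncurry_of_continuous_of_measurable
      (fun x => continuous_iff_continuousAt.2 fun τ => (hg τ x).continuousAt) hgm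
  have hm' : Measurable (Function.uncurry g') := by
    refine measurable_of_tendsto_metrizable
      (f := fun (n : ℕ) p => ((n : ℝ) + 1) * (g (p.1 + ((n : ℝ) + 1)⁻¹) p.2 - g p.1 p.2)) ?_ ?_
    · intro n
      have h1 : Measurable (fun p : ℝ × (ℝ × ℝ) => g (p.1 + ((n : ℝ) + 1)⁻¹) p.2) :=
        hm.comp ((measurable_fst.add_const _).prodMk measurable_snd)
      exact (h1.sub hm).const_mul _
    · rw [tendsto_pi_nhds]
      rintro ⟨τ, x⟩
      have h := (hasDerivAt_iff_tendsto_slope_zero.1 (hg τ x))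
      have hseq : Tendsto (fun n : ℕ => ((n : ℝ) + 1)⁻¹) atTop (𝓝[≠] 0) := by
        refine tendsto_nhdsWithin_iff.2 ⟨?_, Eventually.of_forall fun n => ?_⟩
        · simpa using tendsto_one_div_add_atTop_nhds_zero_nat (𝕜 := ℝ)
        · simp only [mem_compl_iff, mem_singleton_iff, inv_eq_zero]; positivity
      have := h.comp hseq
      simpa [Function.comp_def, Function.uncurry] using this
  have hprod : Integrable (Function.uncurry g') ((volume.restrict (uIoc s t)).prod volume) := by
    rw [integrable_prod_iff hm'.aestronglyMeasurable, uIoc_of_le hst]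
    constructor
    · exact (ae_restrict_iff' measurableSet_Ioc).2
        (Eventually.of_forall fun τ hτ => hgi τ (Ioc_subset_Icc_self hτ))
    · refine Measure.integrableOn_of_bounded (M := M) (by simp)
        (hm'.norm.stronglyMeasurable.integral_prod_right').aestronglyMeasurable ?_
      refine (ae_restrict_iff' measurableSet_Ioc).2 (Eventually.of_forall fun τ hτ => ?_)
      rw [Real.norm_of_nonneg (integral_nonneg fun _ => norm_nonneg _)]
      exact hgM τ (Ioc_subset_Icc_self hτ)
  have hswap := intervalIntegral_integral_swap hprod
  have hae : ∀ᵐ x : ℝ × ℝ, ∫ τ in s..t, g' τ x = g t x - g s x := by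
    filter_upwards [hprod.prod_left_ae] with x hx
    refine intervalIntegral.integral_eq_sub_of_hasDerivAt (fun τ _ => hg τ x) ?_
    rw [intervalIntegrable_iff]
    exact hx
  rw [integral_congr_ae hae, integral_sub hgt hgs] at hswap
  have hii : IntervalIntegrable (fun τ => ∫ x, g' τ x) volume s t := by
    rw [intervalIntegrable_iff]
    exact hprod.integral_prod_left
  have hle : ∫ τ in s..t, ∫ x, g' τ x ≤ ∫ τ in s..t, κ :=
    intervalIntegral.integral_mono_on hst hii (by simp) hκ
  rw [intervalIntegral.integral_const, smul_eq_mul] at hle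
  linarith

/-- Baire argument. -/
lemma baire_bounded {T C : ℝ} {P : ℝ → ℝ → Prop}
    (hmono : ∀ M M' τ, M ≤ M' → P M τ → P M' τ)
    (hfin : ∀ τ, ∃ M, P M τ)
    (hclosed : ∀ M, IsClosed {τ | P M τ})
    (hprop : ∀ s ∈ Icc 0 T, ∀ t ∈ Icc 0 T, ∀ M M', (∀ τ ∈ uIcc s t, P M' τ) → P M s → P (C * M) t) :
    ∃ M, ∀ τ ∈ Icc 0 T, P M τ := by
  classical
  let G : Set ℝ := {τ | ∃ M, ∀ᶠ σ in 𝓝 τ, σ ∈ Icc 0 T → P M σ}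
  have hGo : IsOpen G := by
    rw [isOpen_iff_mem_nhds]
    rintro τ ⟨M, hM⟩
    filter_upwards [hM.eventually_nhds] with σ hσ
    exact ⟨M, hσ⟩
  have hcpt : ∀ K : Set ℝ, IsCompact K → K ⊆ G → ∃ M, ∀ τ ∈ K, τ ∈ Icc 0 T → P M τ := by
    intro K hK hKG
    refine hK.induction_on (p := fun K => ∃ M, ∀ τ ∈ K, τ ∈ Icc 0 T → P M τ) ⟨0, by simp⟩ ?_ ?_ ?_
    · rintro A B hAB ⟨M, hM⟩
      exact ⟨M, fun τ hτ => hM τ (hAB hτ)⟩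
    · rintro A B ⟨M, hM⟩ ⟨M', hM'⟩
      refine ⟨max M M', fun τ hτ h => ?_⟩
      rcases hτ with hτ | hτ
      · exact hmono _ _ _ (le_max_left _ _) (hM τ hτ h)
      · exact hmono _ _ _ (le_max_right _ _) (hM' τ hτ h)
    · intro τ hτ
      obtain ⟨M, hM⟩ := hKG hτ
      exact ⟨_, mem_nhdsWithin_of_mem_nhds hM, M, fun σ hσ => hσ⟩
  let F : Set ℝ := Icc 0 T \ G
  have hFc : IsClosed F := isClosed_Icc.sdiff hGo
  rcases F.eq_empty_or_nonempty with hF | hF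
  · obtain ⟨M, hM⟩ := hcpt (Icc 0 T) isCompact_Icc (sdiff_eq_empty.1 hF)
    exact ⟨M, fun τ hτ => hM τ hτ hτ⟩
  exfalso
  have : Nonempty F := hF.to_subtype
  have : CompleteSpace F := hFc.completeSpace_coe
  obtain ⟨n, τ0, hτ0⟩ := nonempty_interior_of_iUnion_of_closed (X := F)
    (f := fun n : ℕ => {τ : F | P n τ})
    (fun n => (hclosed n).preimage continuous_subtype_val) (by
      refine eq_univ_of_forall fun τ => ?_
      obtain ⟨M, hM⟩ := hfin τ
      obtain ⟨n, hn⟩ := exists_nat_ge M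
      exact mem_iUnion.2 ⟨n, hmono _ _ _ hn hM⟩)
  rw [mem_interior_iff_mem_nhds, nhds_subtype_eq_comap, mem_comap] at hτ0
  obtain ⟨U, hU, hUF⟩ := hτ0
  obtain ⟨r, hr, hrU⟩ := Metric.mem_nhds_iff.1 hU
  have hbd : ∀ a ∈ F, |a - τ0| < r → P n a := fun a ha har =>
    hUF (show (⟨a, ha⟩ : F) ∈ _ from hrU (by simpa [Real.dist_eq] using har))
  apply τ0.2.2
  refine ⟨max (C * n) n, ?_⟩
  filter_upwards [Metric.ball_mem_nhds (τ0 : ℝ) hr] with t htr htT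
  have htr' : |t - τ0| < r := by simpa [Real.dist_eq] using htr
  by_cases htF : t ∈ F
  · exact hmono _ _ _ (le_max_right _ _) (hbd t htF htr')
  refine hmono _ _ _ (le_max_left _ _) ?_
  have hKc : IsCompact (uIcc (τ0 : ℝ) t ∩ F) := isCompact_uIcc.inter_right hFc
  obtain ⟨a, ⟨haI, haF⟩, hamin⟩ := hKc.exists_isMinOn ⟨τ0, left_mem_uIcc, τ0.2⟩
    (f := fun x => |x - t|) (by fun_prop)
  have haT := haF.1
  have har : |a - τ0| < r := by
    refine lt_of_le_of_lt ?_ htr'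
    exact (abs_sub_left_of_mem_uIcc haI)
  have hsub : ∀ s ∈ uIcc a t, s ∈ Icc 0 T := fun s hs => (Set.ordConnected_Icc.uIcc_subset haT htT) hs
  have hnot : ∀ s ∈ uIcc a t, s ≠ a → s ∈ G := by
    intro s hs hsa
    by_contra hsG
    have h1 : s ∈ F := ⟨hsub s hs, hsG⟩
    have h2 : s ∈ uIcc (τ0 : ℝ) t := uIcc_subset_uIcc haI right_mem_uIcc hs
    have h3 := hamin ⟨h2, h1⟩
    simp only [mem_ofPred_eq] at h3
    rw [mem_uIcc] at hs
    apply hsa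
    rcases hs with ⟨h, h'⟩ | ⟨h, h'⟩
    · rw [abs_of_nonpos (by linarith), abs_of_nonpos (by linarith)] at h3; linarith
    · rw [abs_of_nonneg (by linarith), abs_of_nonneg (by linarith)] at h3; linarith
  obtain ⟨Mt, hMt⟩ := hfin t
  have hback : ∀ s ∈ uIcc a t, s ≠ a → P (C * Mt) s := by
    intro s hs hsa
    have hss : uIcc s t ⊆ uIcc a t := uIcc_subset_uIcc hs right_mem_uIcc
    obtain ⟨M', hM'⟩ := hcpt (uIcc s t) isCompact_uIcc (by
      intro σ hσ
      refine hnot σ (hss hσ) ?_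
      rintro rfl
      apply hsa
      rw [mem_uIcc] at hσ hs
      rcases hs with ⟨h, h'⟩ | ⟨h, h'⟩ <;> rcases hσ with ⟨h1, h1'⟩ | ⟨h1, h1'⟩ <;> linarith)
    refine hprop t htT s (hsub s hs) Mt M' ?_ hMt
    intro σ hσ
    rw [uIcc_comm] at hσ
    exact hM' σ hσ (hsub σ (hss hσ))
  refine hprop a haT t htT n (max (C * Mt) n) ?_ (hbd a haF har)
  intro s hs
  by_cases hsa : s = a
  · subst hsa
    exact hmono _ _ _ (le_max_right _ _) (hbd s haF har)
  · exact hmono _ _ _ (le_max_left _ _) (hback s hs hsa)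

/-- first partial derivative as a Schwartz map -/
def sd1 (u : SchwartzMap (ℝ × ℝ) ℝ) : SchwartzMap (ℝ × ℝ) ℝ :=
  LineDeriv.lineDerivOp ((1, 0) : ℝ × ℝ) u

/-- second partial derivative as a Schwartz map -/
def sd2 (u : SchwartzMap (ℝ × ℝ) ℝ) : SchwartzMap (ℝ × ℝ) ℝ :=
  LineDeriv.lineDerivOp ((0, 1) : ℝ × ℝ) u

lemma sd1_apply (u : SchwartzMap (ℝ × ℝ) ℝ) (x : ℝ × ℝ) :
    sd1 u x = fderiv ℝ u x (1, 0) := SchwartzMap.lineDerivOp_apply_eq_fderiv _ _ _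

lemma sd2_apply (u : SchwartzMap (ℝ × ℝ) ℝ) (x : ℝ × ℝ) :
    sd2 u x = fderiv ℝ u x (0, 1) := SchwartzMap.lineDerivOp_apply_eq_fderiv _ _ _

lemma pd1_eq (u : SchwartzMap (ℝ × ℝ) ℝ) (x : ℝ × ℝ) : pd1 u x = sd1 u x := (sd1_apply u x).symm

lemma pd2_eq (u : SchwartzMap (ℝ × ℝ) ℝ) (x : ℝ × ℝ) : pd2 u x = sd2 u x := (sd2_apply u x).symm

lemma int_uv (u v : SchwartzMap (ℝ × ℝ) ℝ) : Integrable (fun x => u x * v x) :=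
  (u.memLp 2).integrable_mul (v.memLp 2)

lemma int_cuv {c : ℝ → ℝ} {B : ℝ} (hc : Continuous c) (hB : ∀ y, |c y| ≤ B)
    (u v : SchwartzMap (ℝ × ℝ) ℝ) : Integrable (fun x : ℝ × ℝ => c x.2 * (u x * v x)) :=
  (int_uv u v).bdd_mul (c := B) (by fun_prop) (Eventually.of_forall fun x => hB x.2)

lemma ibp1 {c : ℝ → ℝ} {B : ℝ} (hc : ContDiff ℝ 1 c) (hB : ∀ y, |c y| ≤ B)
    (u v : SchwartzMap (ℝ × ℝ) ℝ) :
    Integrable (fun x : ℝ × ℝ => c x.2 * (u x * sd1 v x + sd1 u x * v x)) ∧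
    ∫ x : ℝ × ℝ, c x.2 * (u x * sd1 v x + sd1 u x * v x) = 0 := by
  have hi1 := int_cuv hc.continuous hB u (sd1 v)
  have hi2 := int_cuv hc.continuous hB (sd1 u) v
  have hi3 := int_cuv hc.continuous hB u v
  have hcd : ∀ x : ℝ × ℝ, HasFDerivAt (fun x : ℝ × ℝ => c x.2)
      ((deriv c x.2) • ContinuousLinearMap.snd ℝ ℝ ℝ) x := fun x =>
    ((hc.differentiable one_ne_zero x.2).hasDerivAt).comp_hasFDerivAt x hasFDerivAt_snd
  have hfd : ∀ x : ℝ × ℝ, HasFDerivAt (fun z : ℝ × ℝ => c z.2 * u z) _ x := fun x =>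
    (hcd x).mul (u.differentiableAt.hasFDerivAt)
  have hfv : ∀ x : ℝ × ℝ, fderiv ℝ (fun x : ℝ × ℝ => c x.2 * u x) x (1, 0) = c x.2 * sd1 u x := by
    intro x
    rw [(hfd x).fderiv, sd1_apply]
    simp
  have h := integral_mul_fderiv_eq_neg_fderiv_mul_of_integrable (μ := volume)
    (f := fun x : ℝ × ℝ => c x.2 * u x) (g := v) (v := ((1, 0) : ℝ × ℝ))
    (by simp_rw [hfv]; simpa [mul_assoc] using hi2)
    (by simp_rw [← sd1_apply]; simpa [mul_assoc] using hi1)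
    (by simpa [mul_assoc] using hi3)
    (fun x _ => (hfd x).differentiableAt) (fun x _ => v.differentiableAt)
  simp_rw [hfv, ← sd1_apply, mul_assoc] at h
  simp_rw [mul_add]
  refine ⟨hi1.add hi2, ?_⟩
  rw [integral_add hi1 hi2, h]; ring

lemma ibp2 {c : ℝ → ℝ} {B B' : ℝ} (hc : ContDiff ℝ 1 c) (hB : ∀ y, |c y| ≤ B)
    (hB' : ∀ y, |deriv c y| ≤ B')
    (u v : SchwartzMap (ℝ × ℝ) ℝ) :
    Integrable (fun x : ℝ × ℝ => c x.2 * (u x * sd2 v x + sd2 u x * v x)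
      + deriv c x.2 * (u x * v x)) ∧
    ∫ x : ℝ × ℝ, (c x.2 * (u x * sd2 v x + sd2 u x * v x) + deriv c x.2 * (u x * v x)) = 0 := by
  have hi1 := int_cuv hc.continuous hB u (sd2 v)
  have hi2 := int_cuv hc.continuous hB (sd2 u) v
  have hi3 := int_cuv hc.continuous hB u v
  have hi4 := int_cuv (hc.continuous_deriv le_rfl) hB' u v
  have hcd : ∀ x : ℝ × ℝ, HasFDerivAt (fun x : ℝ × ℝ => c x.2)
      ((deriv c x.2) • ContinuousLinearMap.snd ℝ ℝ ℝ) x := fun x =>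
    ((hc.differentiable one_ne_zero x.2).hasDerivAt).comp_hasFDerivAt x hasFDerivAt_snd
  have hfd : ∀ x : ℝ × ℝ, HasFDerivAt (fun z : ℝ × ℝ => c z.2 * u z) _ x := fun x =>
    (hcd x).mul (u.differentiableAt.hasFDerivAt)
  have hfv : ∀ x : ℝ × ℝ, fderiv ℝ (fun x : ℝ × ℝ => c x.2 * u x) x (0, 1)
      = c x.2 * sd2 u x + deriv c x.2 * u x := by
    intro x
    rw [(hfd x).fderiv, sd2_apply]
    simp [mul_comm]
  have e : (fun x : ℝ × ℝ => (c x.2 * sd2 u x + deriv c x.2 * u x) * v x)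
      = fun x => c x.2 * (sd2 u x * v x) + deriv c x.2 * (u x * v x) := by
    ext x; ring
  have h := integral_mul_fderiv_eq_neg_fderiv_mul_of_integrable (μ := volume)
    (f := fun x : ℝ × ℝ => c x.2 * u x) (g := v) (v := ((0, 1) : ℝ × ℝ))
    (by simp_rw [hfv]; rw [e]; exact hi2.add hi4)
    (by simp_rw [← sd2_apply]; simpa [mul_assoc] using hi1)
    (by simpa [mul_assoc] using hi3)
    (fun x _ => (hfd x).differentiableAt) (fun x _ => v.differentiableAt)
  simp_rw [hfv] at h
  rw [e, integral_add hi2 hi4] at h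
  simp_rw [← sd2_apply, mul_assoc] at h
  simp_rw [mul_add]
  refine ⟨(hi1.add hi2).add hi4, ?_⟩
  have h12 : Integrable (fun x : ℝ × ℝ => c x.2 * (u x * sd2 v x) + c x.2 * (sd2 u x * v x)) :=
    hi1.add hi2
  rw [integral_add h12 hi4, integral_add hi1 hi2, h]; ring

/-- admissible weights -/
structure Wt (c : ℝ) (φ : ℝ → ℝ) : Prop where
  cd : ContDiff ℝ 1 φ
  pos : ∀ y, 0 < φ y
  le1 : ∀ y, φ y ≤ 1
  der : ∀ y, |deriv φ y| ≤ c * φ y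

/-- weighted energy -/
def en (φ : ℝ → ℝ) (F : Fin 3 → ℝ × ℝ → ℝ) : ℝ := ∫ x : ℝ × ℝ, φ x.2 * ∑ j, (F j x)^2

lemma Wt.abs {c : ℝ} {φ : ℝ → ℝ} (h : Wt c φ) (y : ℝ) : |φ y| ≤ 1 := by
  rw [abs_of_pos (h.pos y)]; exact h.le1 y

lemma Wt.c_nonneg {c : ℝ} {φ : ℝ → ℝ} (h : Wt c φ) : 0 ≤ c := by
  have := (abs_nonneg _).trans (h.der 0)
  exact nonneg_of_mul_nonneg_left this (h.pos 0)

lemma en_int {c : ℝ} {φ : ℝ → ℝ} (h : Wt c φ) (F : Fin 3 → SchwartzMap (ℝ × ℝ) ℝ) :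
    Integrable (fun x : ℝ × ℝ => φ x.2 * ∑ j, (F j x)^2) := by
  simp_rw [Finset.mul_sum]
  refine integrable_finsetSum _ fun j _ => ?_
  simp_rw [sq]
  exact int_cuv h.cd.continuous h.abs _ _

lemma en_nonneg {c : ℝ} {φ : ℝ → ℝ} (h : Wt c φ) (F : Fin 3 → ℝ × ℝ → ℝ) : 0 ≤ en φ F :=
  integral_nonneg fun x => mul_nonneg (h.pos _).le (Finset.sum_nonneg fun _ _ => sq_nonneg _)

lemma Aop0 (ε : ℝ) (a b : ℝ → ℝ) (U : Fin 3 → SchwartzMap (ℝ × ℝ) ℝ) (x : ℝ × ℝ) :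
    Aop ε a b (fun i => ⇑(U i)) 0 x = ε^2 * a x.2 * sd1 (U 0) x + ε * sd1 (U 1) x
      + ε * sd2 (U 2) x := by
  simp only [← pd1_eq, ← pd2_eq]; rfl

lemma Aop1 (ε : ℝ) (a b : ℝ → ℝ) (U : Fin 3 → SchwartzMap (ℝ × ℝ) ℝ) (x : ℝ × ℝ) :
    Aop ε a b (fun i => ⇑(U i)) 1 x = ε * sd1 (U 0) x + ε^2 * a x.2 * sd1 (U 1) x
      + (-(b x.2) + ε^2 * deriv a x.2) * U 2 x := by
  simp only [← pd1_eq]; rfl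

lemma Aop2 (ε : ℝ) (a b : ℝ → ℝ) (U : Fin 3 → SchwartzMap (ℝ × ℝ) ℝ) (x : ℝ × ℝ) :
    Aop ε a b (fun i => ⇑(U i)) 2 x = ε * sd2 (U 0) x + b x.2 * U 1 x
      + ε^2 * a x.2 * sd1 (U 2) x := by
  simp only [← pd1_eq, ← pd2_eq]; rfl

lemma two_abs_mul_le (x y : ℝ) : 2 * |x * y| ≤ x^2 + y^2 := by
  rw [abs_mul, ← sq_abs x, ← sq_abs y]; nlinarith [sq_nonneg (|x| - |y|)]

/-- coefficient bounds -/
structure Co (Ka K : ℝ) (a : ℝ → ℝ) : Prop where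
  cd : ContDiff ℝ 1 a
  bd : ∀ y, |a y| ≤ Ka
  der : ∀ y, |deriv a y| ≤ K

lemma static_identity {ε c Ka K : ℝ} (hε : 0 < ε) {φ a b : ℝ → ℝ}
    (hφ : Wt c φ) (ha : Co Ka K a)
    (U : Fin 3 → SchwartzMap (ℝ × ℝ) ℝ) (S : Fin 3 → ℝ × ℝ → ℝ)
    (hSi : Integrable (fun x : ℝ × ℝ => φ x.2 * ∑ j, U j x * S j x)) :
    Integrable (fun x : ℝ × ℝ => φ x.2 * (-(2/ε^2) *
      ∑ j, U j x * (Aop ε a b (fun i => ⇑(U i)) j x + S j x))) ∧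
    Integrable (fun x : ℝ × ℝ => (2/ε) * (deriv φ x.2 * (U 0 x * U 2 x))
      - 2 * (φ x.2 * deriv a x.2 * (U 1 x * U 2 x))
      - (2/ε^2) * (φ x.2 * ∑ j, U j x * S j x)) ∧
    ∫ x : ℝ × ℝ, φ x.2 * (-(2/ε^2) *
      ∑ j, U j x * (Aop ε a b (fun i => ⇑(U i)) j x + S j x)) =
    ∫ x : ℝ × ℝ, ((2/ε) * (deriv φ x.2 * (U 0 x * U 2 x))
      - 2 * (φ x.2 * deriv a x.2 * (U 1 x * U 2 x))
      - (2/ε^2) * (φ x.2 * ∑ j, U j x * S j x)) := by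
  have hφa : ∀ y, |φ y * a y| ≤ Ka := by
    intro y
    rw [abs_mul]
    calc |φ y| * |a y| ≤ 1 * |a y| := by gcongr; exact hφ.abs y
      _ ≤ Ka := by simpa using ha.bd y
  have hφa' : ∀ y, |φ y * deriv a y| ≤ K := by
    intro y
    rw [abs_mul]
    calc |φ y| * |deriv a y| ≤ 1 * |deriv a y| := by gcongr; exact hφ.abs y
      _ ≤ K := by simpa using ha.der y
  have hφ' : ∀ y, |deriv φ y| ≤ c := by
    intro y
    refine (hφ.der y).trans ?_
    have := mul_le_mul_of_nonneg_left (hφ.le1 y) hφ.c_nonneg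
    simpa using this
  have hφac : ContDiff ℝ 1 (fun y => φ y * a y) := hφ.cd.mul ha.cd
  obtain ⟨i0, z0⟩ := ibp1 hφac hφa (U 0) (U 0)
  obtain ⟨i1, z1⟩ := ibp1 hφac hφa (U 1) (U 1)
  obtain ⟨i2, z2⟩ := ibp1 hφac hφa (U 2) (U 2)
  obtain ⟨i3, z3⟩ := ibp1 hφ.cd hφ.abs (U 0) (U 1)
  obtain ⟨i4, z4⟩ := ibp2 hφ.cd hφ.abs hφ' (U 0) (U 2)
  have j1 := (int_cuv (hφ.cd.continuous_deriv le_rfl) hφ' (U 0) (U 2)).const_mul (2/ε)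
  have j2 := (int_cuv (hφ.cd.continuous.mul (ha.cd.continuous_deriv le_rfl)) hφa'
    (U 1) (U 2)).const_mul 2
  have j3 := hSi.const_mul (2/ε^2)
  have jR := (j1.sub j2).sub j3
  have hL := ((i0.add i1).add i2).neg
  have hL2 := (i3.const_mul (2/ε)).add (i4.const_mul (2/ε))
  have e : (fun x : ℝ × ℝ => φ x.2 * (-(2/ε^2) *
      ∑ j, U j x * (Aop ε a b (fun i => ⇑(U i)) j x + S j x))) = fun x : ℝ × ℝ =>
      ((-((φ x.2 * a x.2 * (U 0 x * sd1 (U 0) x + sd1 (U 0) x * U 0 x)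
        + φ x.2 * a x.2 * (U 1 x * sd1 (U 1) x + sd1 (U 1) x * U 1 x)
        + φ x.2 * a x.2 * (U 2 x * sd1 (U 2) x + sd1 (U 2) x * U 2 x)))
      - ((2/ε) * (φ x.2 * (U 0 x * sd1 (U 1) x + sd1 (U 0) x * U 1 x))
        + (2/ε) * (φ x.2 * (U 0 x * sd2 (U 2) x + sd2 (U 0) x * U 2 x)
          + deriv φ x.2 * (U 0 x * U 2 x))))
      + ((2/ε) * (deriv φ x.2 * (U 0 x * U 2 x))
        - 2 * (φ x.2 * deriv a x.2 * (U 1 x * U 2 x))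
        - (2/ε^2) * (φ x.2 * ∑ j, U j x * S j x))) := by
    ext x
    simp only [Fin.sum_univ_three, Aop0, Aop1, Aop2]
    field_simp
    ring
  have hint := (hL.sub hL2).add jR
  refine ⟨?_, jR, ?_⟩
  · rw [e]; exact hint
  · rw [e]
    refine (integral_add (hL.sub hL2) jR).trans ?_
    have h1 : ∫ x : ℝ × ℝ, (-((φ x.2 * a x.2 * (U 0 x * sd1 (U 0) x + sd1 (U 0) x * U 0 x)
        + φ x.2 * a x.2 * (U 1 x * sd1 (U 1) x + sd1 (U 1) x * U 1 x)
        + φ x.2 * a x.2 * (U 2 x * sd1 (U 2) x + sd1 (U 2) x * U 2 x)))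
      - ((2/ε) * (φ x.2 * (U 0 x * sd1 (U 1) x + sd1 (U 0) x * U 1 x))
        + (2/ε) * (φ x.2 * (U 0 x * sd2 (U 2) x + sd2 (U 0) x * U 2 x)
          + deriv φ x.2 * (U 0 x * U 2 x)))) = 0 := by
      refine (integral_sub hL hL2).trans ?_
      have hA := integral_neg (μ := volume) (fun x : ℝ × ℝ =>
        (φ x.2 * a x.2 * (U 0 x * sd1 (U 0) x + sd1 (U 0) x * U 0 x)
        + φ x.2 * a x.2 * (U 1 x * sd1 (U 1) x + sd1 (U 1) x * U 1 x)
        + φ x.2 * a x.2 * (U 2 x * sd1 (U 2) x + sd1 (U 2) x * U 2 x)))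
      have hB := integral_add (i0.add i1) i2
      have hC := integral_add i0 i1
      have hD := integral_add (i3.const_mul (2/ε)) (i4.const_mul (2/ε))
      rw [integral_const_mul, integral_const_mul, z3, z4] at hD
      simp only [Pi.add_apply, Pi.neg_apply] at hA hB hC hD ⊢
      rw [hA, hB, hC, hD, z0, z1, z2]
      simp
    exact (congrArg₂ (· + ·) h1 rfl).trans (zero_add _)

lemma static_bound {ε c Ka K η : ℝ} (hε : 0 < ε) (hη : 0 < η) {φ a b : ℝ → ℝ}
    (hφ : Wt c φ) (ha : Co Ka K a)
    (U : Fin 3 → SchwartzMap (ℝ × ℝ) ℝ) (S : Fin 3 → ℝ × ℝ → ℝ)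
    (hSc : ∀ j, Continuous (S j))
    (hSi : Integrable (fun x : ℝ × ℝ => φ x.2 * ∑ j, (S j x)^2)) :
    Integrable (fun x : ℝ × ℝ => φ x.2 * (-(2/ε^2) *
      ∑ j, U j x * (Aop ε a b (fun i => ⇑(U i)) j x + S j x))) ∧
    ∫ x : ℝ × ℝ, |φ x.2 * (-(2/ε^2) *
      ∑ j, U j x * (Aop ε a b (fun i => ⇑(U i)) j x + S j x))| ≤
      (Ka + 2/ε + K + 1/ε^2) * (en φ (fun j => ⇑(U j)) + en φ (fun j => ⇑(sd1 (U j)))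
        + en φ (fun j => ⇑(sd2 (U j))) + en φ S) ∧
    |∫ x : ℝ × ℝ, φ x.2 * (-(2/ε^2) *
      ∑ j, U j x * (Aop ε a b (fun i => ⇑(U i)) j x + S j x))| ≤
      (K + c/ε + η) * en φ (fun j => ⇑(U j)) + en φ S / (η * ε^4) := by
  have hKa : 0 ≤ Ka := (abs_nonneg _).trans (ha.bd 0)
  have hK : 0 ≤ K := (abs_nonneg _).trans (ha.der 0)
  have hc := hφ.c_nonneg
  have eU := en_int hφ U
  have e1 := en_int hφ (fun j => sd1 (U j))
  have e2 := en_int hφ (fun j => sd2 (U j))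
  have hUS : ∀ x, |∑ j, U j x * S j x| ≤ ∑ j, (U j x)^2 + ∑ j, (S j x)^2 := by
    intro x
    refine (Finset.abs_sum_le_sum_abs _ _).trans ?_
    rw [← Finset.sum_add_distrib]
    refine Finset.sum_le_sum fun j _ => ?_
    have := two_abs_mul_le (U j x) (S j x)
    have := abs_nonneg (U j x * S j x)
    linarith
  have hiUS : Integrable (fun x : ℝ × ℝ => φ x.2 * ∑ j, U j x * S j x) := by
    refine (eU.add hSi).mono' ?_ (Eventually.of_forall fun x => ?_)
    · have := hφ.cd.continuous
      refine Continuous.aestronglyMeasurable ?_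
      refine (this.comp continuous_snd).mul ?_
      exact continuous_finsetSum _ fun j _ => (U j).continuous.mul (hSc j)
    · rw [Real.norm_eq_abs, abs_mul, abs_of_pos (hφ.pos _)]
      simp only [Pi.add_apply]
      rw [← mul_add]
      exact mul_le_mul_of_nonneg_left (hUS x) (hφ.pos _).le
  obtain ⟨hint, hR, heq⟩ := static_identity (b := b) hε hφ ha U S hiUS
  refine ⟨hint, ?_, ?_⟩
  · have hsum := (((eU.add e1).add e2).add hSi).const_mul (Ka + 2/ε + K + 1/ε^2)
    refine (integral_mono hint.abs hsum fun x => ?_).trans (le_of_eq ?_)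
    · simp only [Pi.add_apply]
      rw [abs_mul, abs_of_pos (hφ.pos _), ← mul_add, ← mul_add, ← mul_add, mul_left_comm]
      refine mul_le_mul_of_nonneg_left ?_ (hφ.pos _).le
      have hε' : (0:ℝ) ≤ 1/ε := by positivity
      have hε2 : (0:ℝ) ≤ 1/ε^2 := by positivity
      have expand : -(2/ε^2) * ∑ j, U j x * (Aop ε a b (fun i => ⇑(U i)) j x + S j x)
          = a x.2 * (-(2 * (U 0 x * sd1 (U 0) x)) - 2 * (U 1 x * sd1 (U 1) x)
              - 2 * (U 2 x * sd1 (U 2) x))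
            + (1/ε) * (-(2 * (U 0 x * sd1 (U 1) x)) - 2 * (U 1 x * sd1 (U 0) x)
              - 2 * (U 0 x * sd2 (U 2) x) - 2 * (U 2 x * sd2 (U 0) x))
            + deriv a x.2 * (-(2 * (U 1 x * U 2 x)))
            + (1/ε^2) * (-(2 * (U 0 x * S 0 x)) - 2 * (U 1 x * S 1 x) - 2 * (U 2 x * S 2 x)) := by
        simp only [Fin.sum_univ_three, Aop0, Aop1, Aop2]
        field_simp
        ring
      rw [expand]
      have key : ∀ p q : ℝ, -(p^2+q^2) ≤ 2 * (p*q) ∧ 2 * (p*q) ≤ p^2+q^2 := fun p q =>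
        ⟨by nlinarith [sq_nonneg (p+q)], by nlinarith [sq_nonneg (p-q)]⟩
      simp only [Fin.sum_univ_three]
      set N := (U 0 x)^2 + (U 1 x)^2 + (U 2 x)^2 + ((sd1 (U 0) x)^2 + (sd1 (U 1) x)^2
        + (sd1 (U 2) x)^2) + ((sd2 (U 0) x)^2 + (sd2 (U 1) x)^2
        + (sd2 (U 2) x)^2) + ((S 0 x)^2 + (S 1 x)^2 + (S 2 x)^2) with hN
      have hpos : ∀ p : ℝ, 0 ≤ p^2 := sq_nonneg
      have b1 : |-(2 * (U 0 x * sd1 (U 0) x)) - 2 * (U 1 x * sd1 (U 1) x)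
              - 2 * (U 2 x * sd1 (U 2) x)| ≤ N := by
        rw [abs_le]
        constructor <;>
        linarith [key (U 0 x) (sd1 (U 0) x), key (U 1 x) (sd1 (U 1) x), key (U 2 x) (sd1 (U 2) x),
          hpos (sd2 (U 0) x), hpos (sd2 (U 1) x), hpos (sd2 (U 2) x), hpos (S 0 x), hpos (S 1 x),
          hpos (S 2 x)]
      have b2 : |-(2 * (U 0 x * sd1 (U 1) x)) - 2 * (U 1 x * sd1 (U 0) x)
              - 2 * (U 0 x * sd2 (U 2) x) - 2 * (U 2 x * sd2 (U 0) x)| ≤ 2 * N := by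
        rw [abs_le]
        constructor <;>
        linarith [key (U 0 x) (sd1 (U 1) x), key (U 1 x) (sd1 (U 0) x), key (U 0 x) (sd2 (U 2) x),
          key (U 2 x) (sd2 (U 0) x), hpos (U 0 x), hpos (U 1 x), hpos (U 2 x),
          hpos (sd1 (U 0) x), hpos (sd1 (U 1) x), hpos (sd1 (U 2) x),
          hpos (sd2 (U 0) x), hpos (sd2 (U 1) x), hpos (sd2 (U 2) x), hpos (S 0 x), hpos (S 1 x),
          hpos (S 2 x)]
      have b3 : |-(2 * (U 1 x * U 2 x))| ≤ N := by
        rw [abs_le]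
        constructor <;>
        linarith [key (U 1 x) (U 2 x), hpos (U 0 x),
          hpos (sd1 (U 0) x), hpos (sd1 (U 1) x), hpos (sd1 (U 2) x),
          hpos (sd2 (U 0) x), hpos (sd2 (U 1) x), hpos (sd2 (U 2) x), hpos (S 0 x), hpos (S 1 x),
          hpos (S 2 x)]
      have b4 : |-(2 * (U 0 x * S 0 x)) - 2 * (U 1 x * S 1 x) - 2 * (U 2 x * S 2 x)| ≤ N := by
        rw [abs_le]
        constructor <;>
        linarith [key (U 0 x) (S 0 x), key (U 1 x) (S 1 x), key (U 2 x) (S 2 x),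
          hpos (sd1 (U 0) x), hpos (sd1 (U 1) x), hpos (sd1 (U 2) x),
          hpos (sd2 (U 0) x), hpos (sd2 (U 1) x), hpos (sd2 (U 2) x)]
      have hN0 : 0 ≤ N := (abs_nonneg _).trans b1
      refine (abs_add_le _ _).trans ?_
      refine (add_le_add_left ((abs_add_le _ _).trans
        (add_le_add_left (abs_add_le _ _) _)) _).trans ?_
      rw [abs_mul, abs_mul, abs_mul, abs_mul, abs_of_nonneg hε', abs_of_nonneg hε2]
      calc _ ≤ Ka * N + 1/ε * (2 * N) + K * N + 1/ε^2 * N := by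
            gcongr
            · exact ha.bd _
            · exact ha.der _
        _ = _ := by ring
    · rw [integral_const_mul]
      congr 1
      refine (integral_add ((eU.add e1).add e2) hSi).trans ?_
      refine congrArg₂ (· + ·) ?_ rfl
      refine (integral_add (eU.add e1) e2).trans ?_
      refine congrArg₂ (· + ·) ?_ rfl
      exact integral_add eU e1
  · rw [heq]
    refine (abs_integral_le_integral_abs).trans ?_
    have hsum := (eU.const_mul (K + c/ε + η)).add (hSi.div_const (η * ε^4))
    refine (integral_mono hR.abs hsum fun x => ?_).trans (le_of_eq ?_)
    · simp only [Pi.add_apply]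
      have h1 : |(2/ε) * (deriv φ x.2 * (U 0 x * U 2 x))| ≤ c / ε * (φ x.2 * ∑ j, (U j x)^2) := by
        rw [abs_mul, abs_mul, abs_of_pos (by positivity : 0 < 2/ε)]
        have h := two_abs_mul_le (U 0 x) (U 2 x)
        have hd := hφ.der x.2
        have hp := hφ.pos x.2
        have hs : 2 * |U 0 x * U 2 x| ≤ ∑ j, (U j x)^2 := by
          rw [Fin.sum_univ_three]; linarith [sq_nonneg (U 1 x)]
        calc 2/ε * (|deriv φ x.2| * |U 0 x * U 2 x|)
            = 1/ε * (|deriv φ x.2| * (2 * |U 0 x * U 2 x|)) := by ring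
          _ ≤ 1/ε * ((c * φ x.2) * ∑ j, (U j x)^2) := by gcongr
          _ = _ := by ring
      have h2 : |2 * (φ x.2 * deriv a x.2 * (U 1 x * U 2 x))| ≤ K * (φ x.2 * ∑ j, (U j x)^2) := by
        rw [abs_mul, abs_mul, abs_mul, abs_of_pos (hφ.pos _), abs_two]
        have h := two_abs_mul_le (U 1 x) (U 2 x)
        have hd := ha.der x.2
        have hp := hφ.pos x.2
        have hs : 2 * |U 1 x * U 2 x| ≤ ∑ j, (U j x)^2 := by
          rw [Fin.sum_univ_three]; linarith [sq_nonneg (U 0 x)]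
        calc 2 * (φ x.2 * |deriv a x.2| * |U 1 x * U 2 x|)
            = φ x.2 * |deriv a x.2| * (2 * |U 1 x * U 2 x|) := by ring
          _ ≤ φ x.2 * K * ∑ j, (U j x)^2 := by gcongr
          _ = _ := by ring
      have h3 : |(2/ε^2) * (φ x.2 * ∑ j, U j x * S j x)| ≤
          η * (φ x.2 * ∑ j, (U j x)^2) + (φ x.2 * ∑ j, (S j x)^2) / (η * ε^4) := by
        rw [abs_mul, abs_mul, abs_of_pos (hφ.pos _), abs_of_pos (by positivity : 0 < 2/ε^2)]
        have hp := hφ.pos x.2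
        have hs : 2/ε^2 * |∑ j, U j x * S j x| ≤
            η * ∑ j, (U j x)^2 + (∑ j, (S j x)^2) / (η * ε^4) := by
          calc 2/ε^2 * |∑ j, U j x * S j x| ≤ 2/ε^2 * ∑ j, |U j x * S j x| := by
                gcongr; exact Finset.abs_sum_le_sum_abs _ _
            _ = ∑ j, 2/ε^2 * |U j x * S j x| := by rw [Finset.mul_sum]
            _ ≤ ∑ j, (η * (U j x)^2 + (S j x)^2 / (η * ε^4)) := by
                refine Finset.sum_le_sum fun j _ => ?_
                have h := two_abs_mul_le (U j x) (S j x / (η * ε^2))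
                have h' := mul_le_mul_of_nonneg_left h hη.le
                have e1 : |U j x * (S j x / (η * ε^2))| = |U j x * S j x| / (η * ε^2) := by
                  rw [← mul_div_assoc, abs_div, abs_of_pos (by positivity : 0 < η * ε^2)]
                rw [e1] at h'
                calc 2/ε^2 * |U j x * S j x| = η * (2 * (|U j x * S j x| / (η * ε^2))) := by
                      field_simp
                  _ ≤ _ := h'
                  _ = _ := by field_simp
            _ = _ := by rw [Finset.sum_add_distrib, Finset.mul_sum, Finset.sum_div]
        calc 2/ε^2 * (φ x.2 * |∑ j, U j x * S j x|) = φ x.2 * (2/ε^2 * |∑ j, U j x * S j x|) := by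
              ring
          _ ≤ φ x.2 * (η * ∑ j, (U j x)^2 + (∑ j, (S j x)^2) / (η * ε^4)) := by gcongr
          _ = _ := by ring
      refine (abs_sub _ _).trans ?_
      refine (add_le_add_left (abs_sub _ _) _).trans ?_
      calc _ ≤ _ := add_le_add (add_le_add h1 h2) h3
        _ = _ := by ring
    · refine (integral_add (eU.const_mul (K + c/ε + η)) (hSi.div_const (η * ε^4))).trans ?_
      rw [integral_const_mul, integral_div]
      rfl

/-- the evolution hypotheses on a time interval -/
structure Evo (ε η σ M : ℝ) (φ a b : ℝ → ℝ) (W : ℝ → Fin 3 → SchwartzMap (ℝ × ℝ) ℝ)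
    (S : ℝ → Fin 3 → ℝ × ℝ → ℝ) (I : Set ℝ) : Prop where
  diff : ∀ (j : Fin 3) (x : ℝ × ℝ), Differentiable ℝ (fun t => W t j x)
  eq : ∀ t ∈ I, ∀ (j : Fin 3) (x : ℝ × ℝ),
      ε^2 * deriv (fun s => W s j x) t + (Aop ε a b (fun i => ⇑(W t i)) j x + S t j x) = 0
  Sc : ∀ t ∈ I, ∀ j, Continuous (S t j)
  Si : ∀ t ∈ I, Integrable (fun x : ℝ × ℝ => φ x.2 * ∑ j, (S t j x)^2)
  Sb : ∀ t ∈ I, en φ (S t) ≤ (η * ε^4) * σ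
  b0 : ∀ t ∈ I, en φ (fun j => ⇑(W t j)) ≤ M
  b1 : ∀ t ∈ I, en φ (fun j => ⇑(sd1 (W t j))) ≤ M
  b2 : ∀ t ∈ I, en φ (fun j => ⇑(sd2 (W t j))) ≤ M

lemma core_aux {ε η σ M c Ka K : ℝ} {φ a b : ℝ → ℝ} {W : ℝ → Fin 3 → SchwartzMap (ℝ × ℝ) ℝ}
    {S : ℝ → Fin 3 → ℝ × ℝ → ℝ} {s t : ℝ} (hst : s ≤ t) (hε : 0 < ε) (hη : 0 < η)
    (hφ : Wt c φ) (ha : Co Ka K a) (h : Evo ε η σ M φ a b W S (Icc s t))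
    {θ p : ℝ} (hθ : θ = 1 ∨ θ = -1) (hp : ∀ τ ∈ Icc s t, 0 ≤ θ * (τ - p)) :
    θ * Real.exp (-((K + c/ε + η) * (θ * (t - p)))) * en φ (fun j => ⇑(W t j)) ≤
    θ * Real.exp (-((K + c/ε + η) * (θ * (s - p)))) * en φ (fun j => ⇑(W s j)) + σ * (t - s) := by
  set R := K + c/ε + η with hR
  have hKa : 0 ≤ Ka := (abs_nonneg _).trans (ha.bd 0)
  have hK : 0 ≤ K := (abs_nonneg _).trans (ha.der 0)
  have hc := hφ.c_nonneg
  have hR0 : 0 ≤ R := by positivity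
  have hθ2 : θ * θ = 1 := by rcases hθ with rfl | rfl <;> norm_num
  have hθa : |θ| = 1 := by rcases hθ with rfl | rfl <;> norm_num
  have hσ : 0 ≤ σ := by
    have h1 := (en_nonneg hφ (S s)).trans (h.Sb s ⟨le_rfl, hst⟩)
    exact nonneg_of_mul_nonneg_right h1 (by positivity)
  have hM0 : 0 ≤ M := (en_nonneg hφ _).trans (h.b0 s ⟨le_rfl, hst⟩)
  let e : ℝ → ℝ × ℝ → ℝ := fun τ x => φ x.2 * ∑ j, (W τ j x)^2
  let q : ℝ → ℝ × ℝ → ℝ := fun τ x => φ x.2 * ∑ j, 2 * W τ j x * deriv (fun r => W r j x) τ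
  let X : ℝ → ℝ := fun τ => θ * Real.exp (-(R * (θ * (τ - p))))
  have hq : ∀ τ ∈ Icc s t, q τ = fun x : ℝ × ℝ => φ x.2 * (-(2/ε^2) *
      ∑ j, W τ j x * (Aop ε a b (fun i => ⇑(W τ i)) j x + S τ j x)) := by
    intro τ hτ
    ext x
    simp only [q]
    congr 1
    rw [Finset.mul_sum]
    refine Finset.sum_congr rfl fun j _ => ?_
    have := h.eq τ hτ j x
    have h2 : deriv (fun s => W s j x) τ =
        -(1/ε^2) * (Aop ε a b (fun i => ⇑(W τ i)) j x + S τ j x) := by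
      field_simp
      linarith
    rw [h2]; ring
  have hqi : ∀ τ ∈ Icc s t, Integrable (q τ) := by
    intro τ hτ
    rw [hq τ hτ]
    exact (static_bound hε hη hφ ha (W τ) (S τ) (h.Sc τ hτ) (h.Si τ hτ)).1
  have hei : ∀ τ, Integrable (e τ) := fun τ => en_int hφ (W τ)
  have hX1 : ∀ τ ∈ Icc s t, |X τ| ≤ 1 := by
    intro τ hτ
    simp only [X]
    rw [abs_mul, hθa, one_mul, Real.abs_exp, Real.exp_le_one_iff]
    have := mul_nonneg hR0 (hp τ hτ)
    linarith
  have key := ftc_integral (g := fun τ x => X τ * e τ x)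
    (g' := fun τ x => X τ * q τ x - R * θ * X τ * e τ x) (s := s) (t := t)
    (M := (Ka + 2/ε + K + 1/ε^2) * (M + M + M + (η * ε^4) * σ) + R * M) (κ := σ) hst
    (by
      intro τ x
      have h1 : HasDerivAt X (-(R * θ) * X τ) τ := by
        have : HasDerivAt (fun τ => -(R * (θ * (τ - p)))) (-(R * (θ * 1))) τ :=
          ((((hasDerivAt_id τ).sub_const p).const_mul θ).const_mul R).neg
        exact (this.exp.const_mul θ).congr_deriv (by simp only [X]; ring)
      have h2 : HasDerivAt (fun τ => e τ x) (q τ x) τ := by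
        refine HasDerivAt.const_mul _ ?_
        refine HasDerivAt.fun_sum fun j _ => ?_
        have := ((h.diff j x) τ).hasDerivAt.fun_pow 2
        simpa using this
      refine (h1.mul h2).congr_deriv ?_
      ring)
    (by
      intro τ
      refine Continuous.measurable ?_
      have := hφ.cd.continuous
      have h3 : ∀ j, Continuous (W τ j) := fun j => (W τ j).continuous
      simp only [e]
      fun_prop)
    ((hei s).const_mul _) ((hei t).const_mul _)
    (fun τ hτ => ((hqi τ hτ).const_mul _).sub ((hei τ).const_mul _))
    (by
      intro τ hτ
      have hb := (static_bound (b := b) hε hη hφ ha (W τ) (S τ) (h.Sc τ hτ) (h.Si τ hτ)).2.1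
      have hb' : ∫ x, |q τ x| ≤ (Ka + 2/ε + K + 1/ε^2) * (M + M + M + (η * ε^4) * σ) := by
        rw [hq τ hτ]
        refine hb.trans ?_
        have := h.b0 τ hτ
        have := h.b1 τ hτ
        have := h.b2 τ hτ
        have := h.Sb τ hτ
        gcongr
      have : ∫ x, (|q τ x| + R * e τ x) ≤
          (Ka + 2/ε + K + 1/ε^2) * (M + M + M + (η * ε^4) * σ) + R * M := by
        rw [integral_add (hqi τ hτ).abs ((hei τ).const_mul _), integral_const_mul]
        refine add_le_add hb' (mul_le_mul_of_nonneg_left (h.b0 τ hτ) hR0)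
      refine le_trans (integral_mono
        (((hqi τ hτ).const_mul _).sub ((hei τ).const_mul _)).abs
        ((hqi τ hτ).abs.add ((hei τ).const_mul _)) fun x => ?_) this
      simp only [Pi.add_apply]
      have he0 : 0 ≤ e τ x :=
        mul_nonneg (hφ.pos _).le (Finset.sum_nonneg fun _ _ => sq_nonneg _)
      refine (abs_sub _ _).trans ?_
      have := hX1 τ hτ
      rw [abs_mul (X τ), abs_mul (R * θ * X τ), abs_mul (R * θ), abs_mul R, hθa, abs_of_nonneg hR0, abs_of_nonneg he0]
      refine add_le_add ?_ ?_
      · exact mul_le_of_le_one_left (abs_nonneg _) this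
      · refine mul_le_mul_of_nonneg_right ?_ he0
        simpa using mul_le_mul_of_nonneg_left this hR0)
    (by
      intro τ hτ
      rw [integral_sub ((hqi τ hτ).const_mul _) ((hei τ).const_mul _), integral_const_mul,
        integral_const_mul]
      have hb := (static_bound (b := b) hε hη hφ ha (W τ) (S τ) (h.Sc τ hτ) (h.Si τ hτ)).2.2
      rw [← hq τ hτ] at hb
      have hb2 : en φ (S τ) / (η * ε^4) ≤ σ := by
        rw [div_le_iff₀ (by positivity)]; linarith [h.Sb τ hτ]
      have he : ∫ x, e τ x = en φ (fun j => ⇑(W τ j)) := rfl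
      have hb3 : θ * ∫ x, q τ x ≤ R * (∫ x, e τ x) + σ := by
        refine (le_abs_self _).trans ?_
        rw [abs_mul, hθa, one_mul, he]
        linarith
      have hE1 : Real.exp (-(R * (θ * (τ - p)))) ≤ 1 := by
        rw [Real.exp_le_one_iff]
        have := mul_nonneg hR0 (hp τ hτ)
        linarith
      calc X τ * (∫ x, q τ x) - R * θ * X τ * ∫ x, e τ x
          = Real.exp (-(R * (θ * (τ - p)))) * (θ * (∫ x, q τ x) - (θ * θ) * R * ∫ x, e τ x) := by
            simp only [X]; ring
        _ ≤ Real.exp (-(R * (θ * (τ - p)))) * σ := by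
            refine mul_le_mul_of_nonneg_left ?_ (Real.exp_pos _).le
            rw [hθ2]; linarith
        _ ≤ σ := mul_le_of_le_one_left hσ hE1)
  simp only [integral_const_mul] at key
  exact key

lemma core {ε η σ M c Ka K : ℝ} {φ a b : ℝ → ℝ} {W : ℝ → Fin 3 → SchwartzMap (ℝ × ℝ) ℝ}
    {S : ℝ → Fin 3 → ℝ × ℝ → ℝ} {s t : ℝ} (hε : 0 < ε) (hη : 0 < η)
    (hφ : Wt c φ) (ha : Co Ka K a) (h : Evo ε η σ M φ a b W S (uIcc s t)) :
    en φ (fun j => ⇑(W t j)) ≤ Real.exp ((K + c/ε + η) * |t - s|) *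
      (en φ (fun j => ⇑(W s j)) + σ * |t - s|) := by
  rcases le_total s t with hst | hst
  · rw [uIcc_of_le hst] at h
    have k := core_aux hst hε hη hφ ha h (θ := 1) (p := s) (Or.inl rfl)
      (fun τ hτ => by linarith [hτ.1])
    rw [abs_of_nonneg (by linarith)]
    simp only [one_mul, sub_self, mul_zero, neg_zero, Real.exp_zero] at k
    rw [Real.exp_neg, inv_mul_le_iff₀ (Real.exp_pos _)] at k
    exact k
  · rw [uIcc_of_ge hst] at h
    have k := core_aux hst hε hη hφ ha h (θ := -1) (p := s) (Or.inr rfl)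
      (fun τ hτ => by linarith [hτ.2])
    rw [abs_of_nonpos (by linarith)]
    simp only [sub_self, mul_zero, neg_zero, Real.exp_zero] at k
    rw [show -1 * (t - s) = -(t-s) by ring, Real.exp_neg] at k
    rw [← inv_mul_le_iff₀ (Real.exp_pos _)]
    linarith

/-- polynomial weights -/
def wt (m : ℕ) (δ : ℝ) (y : ℝ) : ℝ := Real.exp (-((m : ℝ) * Real.log (1 + (δ * y)^2)))

lemma wt_eq (m : ℕ) (δ y : ℝ) : wt m δ y = ((1 + (δ * y)^2)^m)⁻¹ := by
  rw [wt, Real.exp_neg, Real.exp_nat_mul, Real.exp_log (by positivity)]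

lemma wt_Wt (m : ℕ) {δ : ℝ} (hδ : 0 ≤ δ) : Wt (m * δ) (wt m δ) := by
  have hpos : ∀ y, (0:ℝ) < 1 + (δ * y)^2 := fun y => by positivity
  refine ⟨?_, fun y => Real.exp_pos _, ?_, ?_⟩
  · unfold wt
    refine ContDiff.exp (ContDiff.neg (contDiff_const.mul (ContDiff.log ?_ fun y => (hpos y).ne')))
    fun_prop
  · intro y
    rw [wt_eq]
    refine inv_le_one_of_one_le₀ (one_le_pow₀ ?_)
    nlinarith [sq_nonneg (δ * y)]
  · intro y
    have h1 : HasDerivAt (fun y : ℝ => 1 + (δ * y)^2) (2 * (δ * y) * δ) y := by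
      have := (((hasDerivAt_id y).const_mul δ).fun_pow 2).const_add 1
      simpa using this
    have h2 := ((h1.log (hpos y).ne').const_mul (m:ℝ)).neg.exp
    have h3 : deriv (wt m δ) y = _ := h2.deriv
    rw [h3]
    rw [abs_mul, Real.abs_exp, mul_comm]
    refine mul_le_mul_of_nonneg_right ?_ (Real.exp_pos _).le
    rw [abs_neg, abs_mul, Nat.abs_cast]
    refine mul_le_mul_of_nonneg_left ?_ (Nat.cast_nonneg _)
    rw [abs_div, abs_of_pos (hpos y), div_le_iff₀ (hpos y), abs_mul, abs_of_nonneg hδ, mul_comm]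
    refine mul_le_mul_of_nonneg_left ?_ hδ
    rw [abs_le]
    constructor <;> nlinarith [sq_nonneg (δ * y - 1), sq_nonneg (δ * y + 1)]

lemma wt_le_one_wt (m : ℕ) {δ : ℝ} (hδ : 0 < δ) (hδ1 : δ ≤ 1) (y : ℝ) :
    wt m δ y ≤ ((δ^2)^m)⁻¹ * wt m 1 y := by
  rw [wt_eq, wt_eq, ← mul_inv, ← mul_pow]
  refine inv_anti₀ (by positivity) ?_
  refine pow_le_pow_left₀ (by positivity) ?_ _
  have : δ^2 ≤ 1 := pow_le_one₀ hδ.le hδ1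
  nlinarith

lemma wt_shift (m : ℕ) {h : ℝ} (hh : |h| ≤ 1) (y : ℝ) :
    wt m 1 y ≤ 3^m * wt m 1 (y + h) := by
  have e : (3:ℝ)^m = ((3⁻¹)^m)⁻¹ := by simp
  rw [wt_eq, wt_eq, e, ← mul_inv, ← mul_pow]
  refine inv_anti₀ (by positivity) ?_
  refine pow_le_pow_left₀ (by positivity) ?_ _
  have := abs_le.1 hh
  nlinarith [sq_nonneg (y - h)]

lemma one_Wt : Wt 0 (fun _ => (1:ℝ)) :=
  ⟨contDiff_const, fun _ => one_pos, fun _ => le_rfl, fun _ => by simp⟩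

lemma en_mono {c c' C : ℝ} {φ ψ : ℝ → ℝ} (hφ : Wt c φ) (hψ : Wt c' ψ)
    (h : ∀ y, φ y ≤ C * ψ y) (F : Fin 3 → SchwartzMap (ℝ × ℝ) ℝ) :
    en φ (fun j => ⇑(F j)) ≤ C * en ψ (fun j => ⇑(F j)) := by
  unfold en
  rw [← integral_const_mul]
  refine integral_mono (en_int hφ F) ((en_int hψ F).const_mul C) fun x => ?_
  dsimp only
  rw [← mul_assoc]
  exact mul_le_mul_of_nonneg_right (h _) (Finset.sum_nonneg fun _ _ => sq_nonneg _)

/-- difference operator -/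
def dif (v : ℝ × ℝ) (u : SchwartzMap (ℝ × ℝ) ℝ) : SchwartzMap (ℝ × ℝ) ℝ :=
  u.compSubConstCLM ℝ (-v) - u

lemma dif_apply (v : ℝ × ℝ) (u : SchwartzMap (ℝ × ℝ) ℝ) (x : ℝ × ℝ) :
    dif v u x = u (x + v) - u x := by
  simp [dif]

lemma fderiv_dif (v : ℝ × ℝ) (u : SchwartzMap (ℝ × ℝ) ℝ) (x : ℝ × ℝ) :
    fderiv ℝ (dif v u) x = fderiv ℝ u (x + v) - fderiv ℝ u x := by
  have e : ⇑(dif v u) = fun x => u (x + v) - u x := funext (dif_apply v u)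
  rw [e, fderiv_fun_sub, fderiv_comp_add_right]
  · exact u.differentiable.comp (differentiable_id.add_const v) |>.differentiableAt
  · exact u.differentiableAt

lemma sd1_dif (v : ℝ × ℝ) (u : SchwartzMap (ℝ × ℝ) ℝ) : sd1 (dif v u) = dif v (sd1 u) := by
  ext x
  rw [sd1_apply, fderiv_dif, dif_apply, sd1_apply, sd1_apply]; rfl

lemma sd2_dif (v : ℝ × ℝ) (u : SchwartzMap (ℝ × ℝ) ℝ) : sd2 (dif v u) = dif v (sd2 u) := by
  ext x
  rw [sd2_apply, fderiv_dif, dif_apply, sd2_apply, sd2_apply]; rfl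

lemma en_dif_le (m : ℕ) {v : ℝ × ℝ} (hv : |v.2| ≤ 1) (F : Fin 3 → SchwartzMap (ℝ × ℝ) ℝ) :
    en (wt m 1) (fun j => ⇑(dif v (F j))) ≤ (2 * 3^m + 2) * en (wt m 1) (fun j => ⇑(F j)) := by
  have hφ := wt_Wt m zero_le_one
  have hi := en_int hφ F
  have hs : Integrable (fun x : ℝ × ℝ => wt m 1 (x+v).2 * ∑ j, (F j (x + v))^2) :=
    hi.comp_add_right v
  have hse : ∫ x : ℝ × ℝ, wt m 1 (x+v).2 * ∑ j, (F j (x + v))^2 = en (wt m 1) (fun j => ⇑(F j)) :=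
    integral_add_right_eq_self (μ := volume)
      (fun x : ℝ × ℝ => wt m 1 x.2 * ∑ j, (F j x)^2) v
  have : (2 * 3^m + 2) * en (wt m 1) (fun j => ⇑(F j)) =
      ∫ x : ℝ × ℝ, ((2 * 3^m) * (wt m 1 (x+v).2 * ∑ j, (F j (x + v))^2)
        + 2 * (wt m 1 x.2 * ∑ j, (F j x)^2)) := by
    rw [integral_add (hs.const_mul _) (hi.const_mul _), integral_const_mul, integral_const_mul, hse]
    unfold en
    ring
  rw [this]
  refine integral_mono (en_int hφ fun j => dif v (F j)) ((hs.const_mul _).add (hi.const_mul _))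
    fun x => ?_
  dsimp only
  have hw := wt_shift m hv x.2
  have hp := hφ.pos x.2
  have h1 : ∑ j, (dif v (F j) x)^2 ≤ 2 * ∑ j, (F j (x+v))^2 + 2 * ∑ j, (F j x)^2 := by
    rw [Finset.mul_sum, Finset.mul_sum, ← Finset.sum_add_distrib]
    refine Finset.sum_le_sum fun j _ => ?_
    rw [dif_apply]
    nlinarith [sq_nonneg (F j (x+v) + F j x)]
  have h2 : 0 ≤ ∑ j, (F j (x+v))^2 := Finset.sum_nonneg fun _ _ => sq_nonneg _
  calc wt m 1 x.2 * ∑ j, (dif v (F j) x)^2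
      ≤ wt m 1 x.2 * (2 * ∑ j, (F j (x+v))^2 + 2 * ∑ j, (F j x)^2) := by gcongr
    _ = 2 * (wt m 1 x.2 * ∑ j, (F j (x+v))^2) + 2 * (wt m 1 x.2 * ∑ j, (F j x)^2) := by ring
    _ ≤ 2 * ((3^m * wt m 1 (x.2 + v.2)) * ∑ j, (F j (x+v))^2)
        + 2 * (wt m 1 x.2 * ∑ j, (F j x)^2) := by gcongr
    _ = _ := by simp only [Prod.snd_add]; ring

lemma en_fatou_sd {m : ℕ} {M : ℝ} (F : Fin 3 → SchwartzMap (ℝ × ℝ) ℝ) (v : ℝ × ℝ)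
    (h : ∀ r : ℝ, |r| ≤ 1 → en (wt m 1) (fun j => ⇑(dif (r • v) (F j))) ≤ M * r^2) :
    en (wt m 1) (fun j x => fderiv ℝ (F j) x v) ≤ M := by
  have hφ := wt_Wt m zero_le_one
  let r : ℕ → ℝ := fun n => ((n:ℝ)+1)⁻¹
  have hr0 : ∀ n, 0 < r n := fun n => by positivity
  have hr1 : ∀ n, |r n| ≤ 1 := fun n => by
    rw [abs_of_pos (hr0 n)]
    exact inv_le_one_of_one_le₀ (by linarith [(Nat.cast_nonneg n : (0:ℝ) ≤ n)])
  refine (fatou_real (f := fun n x => ((r n)^2)⁻¹ * (wt m 1 x.2 * ∑ j, (dif (r n • v) (F j) x)^2))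
    ?_ ?_ ?_ ?_).2
  · intro n x
    exact mul_nonneg (by positivity)
      (mul_nonneg (hφ.pos _).le (Finset.sum_nonneg fun _ _ => sq_nonneg _))
  · intro n
    exact (en_int hφ fun j => dif (r n • v) (F j)).const_mul _
  · intro x
    have e : ∀ n, ((r n)^2)⁻¹ * (wt m 1 x.2 * ∑ j, (dif (r n • v) (F j) x)^2) =
        wt m 1 x.2 * ∑ j, ((r n)⁻¹ * (F j (x + r n • v) - F j x))^2 := by
      intro n
      simp_rw [dif_apply, mul_pow, ← Finset.mul_sum, inv_pow]
      ring
    simp_rw [e]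
    refine Tendsto.const_mul _ (tendsto_finsetSum _ fun j _ => Tendsto.pow ?_ 2)
    have hl : HasLineDerivAt ℝ (F j) (fderiv ℝ (F j) x v) x v :=
      ((F j).differentiableAt.hasFDerivAt).hasLineDerivAt v
    have hseq : Tendsto r atTop (𝓝[≠] 0) := by
      refine tendsto_nhdsWithin_iff.2 ⟨?_, Eventually.of_forall fun n => (hr0 n).ne'⟩
      simpa [r] using tendsto_one_div_add_atTop_nhds_zero_nat (𝕜 := ℝ)
    have := (hasLineDerivAt_iff_tendsto_slope_zero.1 hl).comp hseq
    simpa [Function.comp_def] using this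
  · intro n
    rw [integral_const_mul, inv_mul_le_iff₀ (by have := hr0 n; positivity), mul_comm]
    exact h (r n) (hr1 n)

lemma en_dif_fin (m : ℕ) (F : Fin 3 → SchwartzMap (ℝ × ℝ) ℝ) :
    ∃ M, ∀ v : ℝ × ℝ, ‖v‖ ≤ 1 →
      en (wt m 1) (fun j => ⇑(dif v (F j))) ≤ M * ‖v‖^2 := by
  have hφ := wt_Wt m zero_le_one
  have hD : ∀ j, ∃ C, ∀ x, (1 + ‖x‖)^2 * ‖fderiv ℝ (F j) x‖ ≤ C := by
    intro j
    refine ⟨2^2 * (Finset.Iic ((2,1) : ℕ × ℕ)).sup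
      (fun m => SchwartzMap.seminorm ℝ m.1 m.2) (F j), fun x => ?_⟩
    have := SchwartzMap.one_add_le_sup_seminorm_apply (𝕜 := ℝ) (m := (2,1)) (k := 2) (n := 1)
      le_rfl le_rfl (F j) x
    rwa [norm_iteratedFDeriv_one] at this
  choose C hC using hD
  have hI : Integrable (fun x : ℝ × ℝ => (1 + ‖x‖)^(-(4:ℝ))) :=
    integrable_one_add_norm (by simp; norm_num)
  refine ⟨∫ x : ℝ × ℝ, (∑ j, (4 * C j)^2) * (1 + ‖x‖)^(-(4:ℝ)), fun v hv => ?_⟩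
  rw [← integral_mul_const]
  refine integral_mono (en_int hφ fun j => dif v (F j)) ((hI.const_mul _).mul_const _) fun x => ?_
  dsimp only
  have hx : 0 < 1 + ‖x‖ := by positivity
  have hd : ∀ j, |dif v (F j) x| ≤ 4 * C j / (1 + ‖x‖)^2 * ‖v‖ := by
    intro j
    rw [dif_apply]
    have := (convex_segment x (x+v)).norm_image_sub_le_of_norm_fderiv_le (𝕜 := ℝ) (f := F j)
      (C := 4 * C j / (1 + ‖x‖)^2) (x := x) (y := x + v)
      (fun z _ => (F j).differentiableAt) ?_ (left_mem_segment _ _ _) (right_mem_segment _ _ _)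
    · simpa using this
    · intro z hz
      have hzx : ‖z - x‖ ≤ ‖v‖ := by
        rw [segment_eq_image'] at hz
        obtain ⟨θ, hθ, rfl⟩ := hz
        simp only [add_sub_cancel_left, norm_smul, Real.norm_eq_abs, abs_of_nonneg hθ.1]
        exact mul_le_of_le_one_left (norm_nonneg _) hθ.2
      have h2 : 1 + ‖x‖ ≤ 2 * (1 + ‖z‖) := by
        have : ‖x‖ ≤ ‖z‖ + ‖z - x‖ := by
          have := norm_sub_le z (z - x); simpa using this
        linarith [norm_nonneg z]
      rw [le_div_iff₀ (by positivity)]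
      have h3 := hC j z
      have h4 : (1 + ‖x‖)^2 ≤ (2 * (1 + ‖z‖))^2 := pow_le_pow_left₀ hx.le h2 2
      have h5 := mul_le_mul_of_nonneg_left h4 (norm_nonneg (fderiv ℝ (F j) z))
      linarith
  have e4 : (1 + ‖x‖)^(-(4:ℝ)) = ((1 + ‖x‖)^4)⁻¹ := by
    rw [Real.rpow_neg hx.le]
    norm_cast
  rw [e4]
  calc wt m 1 x.2 * ∑ j, (dif v (F j) x)^2 ≤ 1 * ∑ j, (dif v (F j) x)^2 := by
        gcongr
        exact hφ.le1 _
    _ ≤ ∑ j, (4 * C j / (1 + ‖x‖)^2 * ‖v‖)^2 := by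
        rw [one_mul]
        refine Finset.sum_le_sum fun j _ => ?_
        rw [← sq_abs]
        exact pow_le_pow_left₀ (abs_nonneg _) (hd j) 2
    _ = _ := by
        rw [Finset.sum_mul, Finset.sum_mul]
        refine Finset.sum_congr rfl fun j _ => ?_
        field_simp

/-- the uniform bounds propagated by the system -/
structure PP (n : ℕ) (M : ℝ) (F : Fin 3 → SchwartzMap (ℝ × ℝ) ℝ) : Prop where
  l2 : en (fun _ => 1) (fun j => ⇑(F j)) ≤ M
  d1 : ∀ h : ℝ, |h| ≤ 1 → en (wt n 1) (fun j => ⇑(dif (h, 0) (F j))) ≤ M * h^2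
  d2 : ∀ h : ℝ, |h| ≤ 1 → en (wt n 1) (fun j => ⇑(dif (0, h) (F j))) ≤ M * h^2

lemma PP.mono {n : ℕ} {M M' : ℝ} {F : Fin 3 → SchwartzMap (ℝ × ℝ) ℝ} (h : M ≤ M')
    (hP : PP n M F) : PP n M' F :=
  ⟨hP.l2.trans h, fun r hr => (hP.d1 r hr).trans (by gcongr),
    fun r hr => (hP.d2 r hr).trans (by gcongr)⟩

lemma PP.nonneg {n : ℕ} {M : ℝ} {F : Fin 3 → SchwartzMap (ℝ × ℝ) ℝ} (hP : PP n M F) : 0 ≤ M :=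
  (en_nonneg one_Wt _).trans hP.l2

lemma PP_fin (n : ℕ) (F : Fin 3 → SchwartzMap (ℝ × ℝ) ℝ) : ∃ M, PP n M F := by
  obtain ⟨M, hM⟩ := en_dif_fin n F
  refine ⟨max (en (fun _ => 1) (fun j => ⇑(F j))) M, le_max_left _ _, fun h hh => ?_, fun h hh => ?_⟩
  · have e : ‖((h, 0) : ℝ × ℝ)‖ = |h| := by simp
    have := hM (h, 0) (by rw [e]; exact hh)
    rw [e, sq_abs] at this
    exact this.trans (mul_le_mul_of_nonneg_right (le_max_right _ _) (sq_nonneg _))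
  · have e : ‖((0, h) : ℝ × ℝ)‖ = |h| := by simp
    have := hM (0, h) (by rw [e]; exact hh)
    rw [e, sq_abs] at this
    exact this.trans (mul_le_mul_of_nonneg_right (le_max_right _ _) (sq_nonneg _))

lemma en_closed {c : ℝ} {φ : ℝ → ℝ} (hφ : Wt c φ) {W : ℕ → Fin 3 → SchwartzMap (ℝ × ℝ) ℝ}
    {F : Fin 3 → SchwartzMap (ℝ × ℝ) ℝ} {B : ℝ}
    (hl : ∀ j x, Tendsto (fun k => W k j x) atTop (𝓝 (F j x)))
    (hB : ∀ k, en φ (fun j => ⇑(W k j)) ≤ B) : en φ (fun j => ⇑(F j)) ≤ B :=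
  (fatou_real (f := fun k x => φ x.2 * ∑ j, (W k j x)^2)
    (fun _ _ => mul_nonneg (hφ.pos _).le (Finset.sum_nonneg fun _ _ => sq_nonneg _))
    (fun k => en_int hφ (W k))
    (fun x => Tendsto.const_mul _ (tendsto_finsetSum _ fun j _ => (hl j x).pow 2)) hB).2

lemma PP_closed (n : ℕ) (M : ℝ) {V : ℝ → Fin 3 → SchwartzMap (ℝ × ℝ) ℝ}
    (hV : ∀ (j : Fin 3) (x : ℝ × ℝ), Differentiable ℝ (fun t => V t j x)) :
    IsClosed {τ | PP n M (V τ)} := by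
  refine IsSeqClosed.isClosed fun u τ hu hτ => ?_
  have hl : ∀ j x, Tendsto (fun k => V (u k) j x) atTop (𝓝 (V τ j x)) := fun j x =>
    ((hV j x).continuous.tendsto τ).comp hτ
  have hd : ∀ v j x, Tendsto (fun k => dif v (V (u k) j) x) atTop (𝓝 (dif v (V τ j) x)) := by
    intro v j x
    simp only [dif_apply]
    exact (hl j _).sub (hl j _)
  exact ⟨en_closed one_Wt hl fun k => (hu k).l2,
    fun h hh => en_closed (wt_Wt n zero_le_one) (hd (h, 0)) fun k => (hu k).d1 h hh,
    fun h hh => en_closed (wt_Wt n zero_le_one) (hd (0, h)) fun k => (hu k).d2 h hh⟩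

lemma PP.sd1 {n : ℕ} {M : ℝ} {F : Fin 3 → SchwartzMap (ℝ × ℝ) ℝ}
    (h : ∀ h : ℝ, |h| ≤ 1 → en (wt n 1) (fun j => ⇑(dif (h, 0) (F j))) ≤ M * h^2) :
    en (wt n 1) (fun j => ⇑(sd1 (F j))) ≤ M := by
  have := en_fatou_sd (m := n) (M := M) F (1, 0) (fun r hr => by simpa using h r hr)
  have e : (fun j => ⇑(_root_.sd1 (F j))) = fun j x => fderiv ℝ (F j) x (1, 0) := by
    funext j x; exact sd1_apply _ _
  rw [e]; exact this

lemma PP.sd2 {n : ℕ} {M : ℝ} {F : Fin 3 → SchwartzMap (ℝ × ℝ) ℝ}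
    (h : ∀ h : ℝ, |h| ≤ 1 → en (wt n 1) (fun j => ⇑(dif (0, h) (F j))) ≤ M * h^2) :
    en (wt n 1) (fun j => ⇑(sd2 (F j))) ≤ M := by
  have := en_fatou_sd (m := n) (M := M) F (0, 1) (fun r hr => by simpa using h r hr)
  have e : (fun j => ⇑(_root_.sd2 (F j))) = fun j x => fderiv ℝ (F j) x (0, 1) := by
    funext j x; exact sd2_apply _ _
  rw [e]; exact this

lemma l2_est {ε Ka K M : ℝ} {a b : ℝ → ℝ} {V : ℝ → Fin 3 → SchwartzMap (ℝ × ℝ) ℝ} {n : ℕ}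
    {s t : ℝ} (hε : 0 < ε) (ha : Co Ka K a)
    (hV : ∀ (j : Fin 3) (x : ℝ × ℝ), Differentiable ℝ (fun t => V t j x))
    (heq : ∀ τ ∈ uIcc s t, ∀ (j : Fin 3) (x : ℝ × ℝ),
      ε^2 * deriv (fun s => V s j x) τ + Aop ε a b (fun i => ⇑(V τ i)) j x = 0)
    (hP : ∀ τ ∈ uIcc s t, PP n M (V τ)) :
    en (fun _ => 1) (fun j => ⇑(V t j)) ≤
      Real.exp (K * |t - s|) * en (fun _ => 1) (fun j => ⇑(V s j)) := by
  have hM : 0 ≤ M := (hP s left_mem_uIcc).nonneg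
  have hφ := wt_Wt n zero_le_one
  have key : ∀ δ : ℝ, 0 < δ → δ ≤ 1 → en (wt n δ) (fun j => ⇑(V t j)) ≤
      Real.exp ((K + n * δ / ε + δ) * |t - s|) * en (fun _ => 1) (fun j => ⇑(V s j)) := by
    intro δ hδ hδ1
    have hw := wt_Wt n hδ.le
    have hE : Evo ε δ 0 (M + ((δ^2)^n)⁻¹ * M) (wt n δ) a b V (fun _ _ _ => 0) (uIcc s t) := by
      have hp : 0 ≤ ((δ^2)^n)⁻¹ * M := by positivity
      refine ⟨hV, ?_, fun _ _ _ => continuous_const, ?_, ?_, ?_, ?_, ?_⟩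
      · intro τ hτ j x; rw [add_zero]; exact heq τ hτ j x
      · intro τ hτ; simp
      · intro τ hτ; simp [en]
      · intro τ hτ
        have := en_mono hw one_Wt (C := 1) (fun y => by simpa using hw.le1 y) (V τ)
        linarith [(hP τ hτ).l2]
      · intro τ hτ
        have := en_mono hw hφ (wt_le_one_wt n hδ hδ1) (fun j => sd1 (V τ j))
        have h2 := mul_le_mul_of_nonneg_left (PP.sd1 (hP τ hτ).d1)
          (by positivity : 0 ≤ ((δ^2)^n)⁻¹)
        linarith
      · intro τ hτ
        have := en_mono hw hφ (wt_le_one_wt n hδ hδ1) (fun j => sd2 (V τ j))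
        have h2 := mul_le_mul_of_nonneg_left (PP.sd2 (hP τ hτ).d2)
          (by positivity : 0 ≤ ((δ^2)^n)⁻¹)
        linarith
    refine (core hε hδ hw ha hE).trans ?_
    refine mul_le_mul_of_nonneg_left ?_ (Real.exp_pos _).le
    have := en_mono hw one_Wt (C := 1) (fun y => by simpa using hw.le1 y) (V s)
    linarith
  let r : ℕ → ℝ := fun k => ((k:ℝ)+1)⁻¹
  have hr0 : ∀ k, 0 < r k := fun k => by positivity
  have hr1 : ∀ k, r k ≤ 1 := fun k =>
    inv_le_one_of_one_le₀ (by linarith [(Nat.cast_nonneg k : (0:ℝ) ≤ k)])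
  have hr : Tendsto r atTop (𝓝 0) := by
    simpa [r] using tendsto_one_div_add_atTop_nhds_zero_nat (𝕜 := ℝ)
  have hL : Tendsto (fun k => en (wt n (r k)) (fun j => ⇑(V t j))) atTop
      (𝓝 (en (fun _ => 1) (fun j => ⇑(V t j)))) := by
    unfold en
    refine tendsto_integral_of_dominated_convergence
      (fun x : ℝ × ℝ => (1:ℝ) * ∑ j, (V t j x)^2) ?_ (en_int one_Wt (V t)) ?_ ?_
    · intro k; exact (en_int (wt_Wt n (hr0 k).le) (V t)).aestronglyMeasurable
    · intro k
      refine Eventually.of_forall fun x => ?_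
      have hs : 0 ≤ ∑ j, (V t j x)^2 := Finset.sum_nonneg fun _ _ => sq_nonneg _
      have hw := wt_Wt n (hr0 k).le
      rw [Real.norm_eq_abs, abs_of_nonneg (mul_nonneg (hw.pos _).le hs)]
      exact mul_le_mul_of_nonneg_right (hw.le1 _) hs
    · refine Eventually.of_forall fun x => ?_
      refine Tendsto.mul_const _ ?_
      have hc : Continuous fun δ : ℝ => wt n δ x.2 := by
        unfold wt
        refine Real.continuous_exp.comp (continuous_const.mul (Continuous.log (by fun_prop) ?_)).neg
        intro δ; positivity
      have := (hc.tendsto 0).comp hr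
      simpa [wt, Function.comp_def] using this
  have hR : Tendsto (fun k => Real.exp ((K + n * r k / ε + r k) * |t - s|) *
      en (fun _ => 1) (fun j => ⇑(V s j))) atTop
      (𝓝 (Real.exp (K * |t - s|) * en (fun _ => 1) (fun j => ⇑(V s j)))) := by
    have hc : Continuous fun δ : ℝ => Real.exp ((K + n * δ / ε + δ) * |t - s|) *
      en (fun _ => 1) (fun j => ⇑(V s j)) := by fun_prop
    have := (hc.tendsto 0).comp hr
    simpa [Function.comp_def] using this
  exact le_of_tendsto_of_tendsto' hL hR fun k => key (r k) (hr0 k) (hr1 k)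

/-- full coefficient assumptions -/
structure Cf (n : ℕ) (Ka K K2 C : ℝ) (a b : ℝ → ℝ) : Prop where
  co : Co Ka K a
  lip : ∀ y h, |a (y + h) - a y| ≤ K * |h|
  lip' : ∀ y h, |deriv a (y + h) - deriv a y| ≤ K2 * |h|
  bc : Continuous b
  blip : ∀ y h, |h| ≤ 1 → |b (y + h) - b y| ≤ |h| * (C * (2 + |y|)^n)

/-- commutator source term -/
def src (ε : ℝ) (a b : ℝ → ℝ) (v : ℝ × ℝ) (U : Fin 3 → SchwartzMap (ℝ × ℝ) ℝ) :
    Fin 3 → ℝ × ℝ → ℝ := fun j x =>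
  Aop ε (fun y => a (y + v.2)) (fun y => b (y + v.2)) (fun i => ⇑(U i)) j x
    - Aop ε a b (fun i => ⇑(U i)) j x

lemma wt_poly (n : ℕ) (y : ℝ) : wt n 1 y * ((2 + |y|)^n)^2 ≤ 8^n := by
  rw [wt_eq, inv_mul_le_iff₀ (by positivity), ← mul_pow, ← pow_mul, mul_comm n 2, pow_mul]
  refine pow_le_pow_left₀ (by positivity) ?_ n
  have := sq_abs y
  nlinarith [sq_nonneg (|y| - 1), abs_nonneg y]

/-- constant for the source term -/
def Cs (ε : ℝ) (n : ℕ) (K K2 C : ℝ) : ℝ := 3 * (ε^4 * K^2 + C^2 * 8^n + ε^4 * K2^2)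

lemma src_bound {ε Ka K K2 C : ℝ} {n : ℕ} {a b : ℝ → ℝ} (hc : Cf n Ka K K2 C a b)
    {v : ℝ × ℝ} (hv : |v.2| ≤ 1) (U : Fin 3 → SchwartzMap (ℝ × ℝ) ℝ) :
    (∀ j, Continuous (src ε a b v U j)) ∧
    Integrable (fun x : ℝ × ℝ => wt n 1 x.2 * ∑ j, (src ε a b v U j x)^2) ∧
    en (wt n 1) (src ε a b v U) ≤ v.2^2 * Cs ε n K K2 C *
      (en (wt n 1) (fun j => ⇑(sd1 (U j))) + en (fun _ => 1) (fun j => ⇑(U j))) := by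
  have hφ := wt_Wt n zero_le_one
  set A : ℝ → ℝ := fun y => a (y + v.2) - a y with hA
  set A' : ℝ → ℝ := fun y => deriv a (y + v.2) - deriv a y with hA'
  set B : ℝ → ℝ := fun y => b (y + v.2) - b y with hB
  have hda : ∀ y, deriv (fun y => a (y + v.2)) y = deriv a (y + v.2) := fun y =>
    deriv_comp_add_const _ _ _
  have e0 : ∀ x, src ε a b v U 0 x = ε^2 * A x.2 * sd1 (U 0) x := fun x => by
    simp only [src, Aop0, hA]; ring
  have e1 : ∀ x, src ε a b v U 1 x = ε^2 * A x.2 * sd1 (U 1) x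
      + (-(B x.2) + ε^2 * A' x.2) * U 2 x := fun x => by
    simp only [src, Aop1, hda, hA, hA', hB]; ring
  have e2 : ∀ x, src ε a b v U 2 x = B x.2 * U 1 x + ε^2 * A x.2 * sd1 (U 2) x := fun x => by
    simp only [src, Aop2, hA, hB]; ring
  have hac := hc.co.cd.continuous
  have hac' := hc.co.cd.continuous_deriv le_rfl
  have hbc := hc.bc
  have hAc : Continuous A := by fun_prop
  have hAc' : Continuous A' := by fun_prop
  have hBc : Continuous B := by fun_prop
  have hcont : ∀ j, Continuous (src ε a b v U j) := by
    intro j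
    have hU : ∀ i, Continuous (U i) := fun i => (U i).continuous
    have hU1 : ∀ i, Continuous (sd1 (U i)) := fun i => (sd1 (U i)).continuous
    fin_cases j
    · change Continuous (src ε a b v U 0)
      rw [show src ε a b v U _ = _ from funext e0]; fun_prop
    · change Continuous (src ε a b v U 1)
      rw [show src ε a b v U _ = _ from funext e1]; fun_prop
    · change Continuous (src ε a b v U 2)
      rw [show src ε a b v U _ = _ from funext e2]; fun_prop
  have hI := ((en_int hφ fun j => sd1 (U j)).add (en_int one_Wt U)).const_mul (v.2^2 * Cs ε n K K2 C)
  have hpt : ∀ x : ℝ × ℝ, wt n 1 x.2 * ∑ j, (src ε a b v U j x)^2 ≤ v.2^2 * Cs ε n K K2 C *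
      (wt n 1 x.2 * ∑ j, (sd1 (U j) x)^2 + 1 * ∑ j, (U j x)^2) := by
    intro x
    have hw0 := (hφ.pos x.2).le
    have hw1 := hφ.le1 x.2
    have hsq : ∀ {p q : ℝ}, |p| ≤ q → p^2 ≤ q^2 := fun {p q} h => by
      rw [← sq_abs p]; exact pow_le_pow_left₀ (abs_nonneg _) h 2
    have q1 : (A x.2)^2 ≤ K^2 * v.2^2 := by
      have := hsq (hc.lip x.2 v.2); rwa [mul_pow, sq_abs] at this
    have q2 : (A' x.2)^2 ≤ K2^2 * v.2^2 := by
      have := hsq (hc.lip' x.2 v.2); rwa [mul_pow, sq_abs] at this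
    have q3 : wt n 1 x.2 * (B x.2)^2 ≤ C^2 * 8^n * v.2^2 := by
      have h1 := hsq (hc.blip x.2 v.2 hv)
      rw [mul_pow, sq_abs, mul_pow] at h1
      have h2 := mul_le_mul_of_nonneg_left h1 hw0
      have h3 := mul_le_mul_of_nonneg_left (wt_poly n x.2) (by positivity : 0 ≤ v.2^2 * C^2)
      linarith
    simp only [Fin.sum_univ_three, e0, e1, e2]
    generalize wt n 1 x.2 = w at *
    generalize sd1 (U 0) x = p0
    generalize sd1 (U 1) x = p1
    generalize sd1 (U 2) x = p2
    generalize U 0 x = u0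
    generalize U 1 x = u1
    generalize U 2 x = u2
    generalize A x.2 = α at *
    generalize A' x.2 = α' at *
    generalize B x.2 = β at *
    set h := v.2
    have s1 : (ε^2*α*p1 + (-β + ε^2*α')*u2)^2 ≤
        3*((ε^2*α*p1)^2 + (β*u2)^2 + (ε^2*α'*u2)^2) := by
      nlinarith [sq_nonneg (ε^2*α*p1 + β*u2), sq_nonneg (ε^2*α*p1 - ε^2*α'*u2),
        sq_nonneg (β*u2 + ε^2*α'*u2)]
    have s2 : (β*u1 + ε^2*α*p2)^2 ≤ 2*((β*u1)^2 + (ε^2*α*p2)^2) := by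
      nlinarith [sq_nonneg (β*u1 - ε^2*α*p2)]
    have tA : ∀ p : ℝ, w * (ε^2*α*p)^2 ≤ h^2 * (ε^4*K^2) * (w * p^2) := by
      intro p
      have := mul_le_mul_of_nonneg_left q1 (by positivity : 0 ≤ w * ε^4 * p^2)
      linarith
    have tB : ∀ u : ℝ, w * (β*u)^2 ≤ h^2 * (C^2*8^n) * u^2 := by
      intro u
      have := mul_le_mul_of_nonneg_right q3 (sq_nonneg u)
      linarith
    have tC : ∀ u : ℝ, w * (ε^2*α'*u)^2 ≤ h^2 * (ε^4*K2^2) * u^2 := by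
      intro u
      have := mul_le_mul_of_nonneg_left q2 (by positivity : 0 ≤ w * ε^4 * u^2)
      have h2 := mul_le_mul_of_nonneg_right hw1 (by positivity : 0 ≤ h^2 * (ε^4*K2^2) * u^2)
      linarith
    have s1' := mul_le_mul_of_nonneg_left s1 hw0
    have s2' := mul_le_mul_of_nonneg_left s2 hw0
    have a0 := tA p0
    have a1 := tA p1
    have a2 := tA p2
    have b1 := tB u1
    have b2 := tB u2
    have c2 := tC u2
    unfold Cs
    have X0 : 0 ≤ h^2 * (ε^4*K^2) := by positivity
    have Y0 : 0 ≤ h^2 * (C^2*8^n) := by positivity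
    have Z0 : 0 ≤ h^2 * (ε^4*K2^2) := by positivity
    have r1 : h^2 * (3 * (ε^4*K^2 + C^2*8^n + ε^4*K2^2)) =
      3 * (h^2 * (ε^4*K^2) + h^2 * (C^2*8^n) + h^2 * (ε^4*K2^2)) := by ring
    rw [r1]
    generalize h^2 * (ε^4*K^2) = X at *
    generalize h^2 * (C^2*8^n) = Y at *
    generalize h^2 * (ε^4*K2^2) = Z at *
    have P0 : 0 ≤ w * p0^2 := by positivity
    have P1 : 0 ≤ w * p1^2 := by positivity
    have P2 : 0 ≤ w * p2^2 := by positivity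
    have m1 := mul_nonneg X0 P0
    have m2 := mul_nonneg X0 P1
    have m3 := mul_nonneg X0 P2
    have m4 := mul_nonneg Y0 P0
    have m5 := mul_nonneg Y0 P1
    have m6 := mul_nonneg Y0 P2
    have m7 := mul_nonneg Z0 P0
    have m8 := mul_nonneg Z0 P1
    have m9 := mul_nonneg Z0 P2
    have k1 := mul_nonneg X0 (sq_nonneg u0)
    have k2 := mul_nonneg X0 (sq_nonneg u1)
    have k3 := mul_nonneg X0 (sq_nonneg u2)
    have k4 := mul_nonneg Y0 (sq_nonneg u0)
    have k5 := mul_nonneg Y0 (sq_nonneg u1)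
    have k6 := mul_nonneg Y0 (sq_nonneg u2)
    have k7 := mul_nonneg Z0 (sq_nonneg u0)
    have k8 := mul_nonneg Z0 (sq_nonneg u1)
    have k9 := mul_nonneg Z0 (sq_nonneg u2)
    linarith
  have hSi : Integrable (fun x : ℝ × ℝ => wt n 1 x.2 * ∑ j, (src ε a b v U j x)^2) := by
    refine hI.mono' ?_ (Eventually.of_forall fun x => ?_)
    · have := hφ.cd.continuous
      exact Continuous.aestronglyMeasurable (by fun_prop)
    · rw [Real.norm_eq_abs, abs_of_nonneg
        (mul_nonneg (hφ.pos _).le (Finset.sum_nonneg fun _ _ => sq_nonneg _))]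
      exact hpt x
  refine ⟨hcont, hSi, ?_⟩
  unfold en
  rw [← integral_add (en_int hφ fun j => sd1 (U j)) (en_int one_Wt U), ← integral_const_mul]
  exact integral_mono hSi hI hpt

lemma Aop_dif (ε : ℝ) (a b : ℝ → ℝ) (v : ℝ × ℝ) (U : Fin 3 → SchwartzMap (ℝ × ℝ) ℝ)
    (j : Fin 3) (x : ℝ × ℝ) :
    Aop ε (fun y => a (y + v.2)) (fun y => b (y + v.2)) (fun i => ⇑(dif v (U i))) j x
      + src ε a b v U j x =
    Aop ε a b (fun i => ⇑(U i)) j (x + v) - Aop ε a b (fun i => ⇑(U i)) j x := by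
  have hda : ∀ y, deriv (fun y => a (y + v.2)) y = deriv a (y + v.2) := fun y =>
    deriv_comp_add_const _ _ _
  fin_cases j
  · simp only [src, Fin.zero_eta, Aop0, sd1_dif, sd2_dif, dif_apply, Prod.snd_add]; ring
  · simp only [src, Fin.mk_one, Aop1, sd1_dif, dif_apply, Prod.snd_add, hda]; ring
  · simp only [src, Fin.reduceFinMk, Aop2, sd1_dif, sd2_dif, dif_apply, Prod.snd_add]; ring

lemma dif_est {ε Ka K K2 C M B : ℝ} {a b : ℝ → ℝ} {V : ℝ → Fin 3 → SchwartzMap (ℝ × ℝ) ℝ} {n : ℕ}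
    {s t : ℝ} (hε : 0 < ε) (hc : Cf n Ka K K2 C a b)
    (hV : ∀ (j : Fin 3) (x : ℝ × ℝ), Differentiable ℝ (fun t => V t j x))
    (heq : ∀ τ ∈ uIcc s t, ∀ (j : Fin 3) (x : ℝ × ℝ),
      ε^2 * deriv (fun s => V s j x) τ + Aop ε a b (fun i => ⇑(V τ i)) j x = 0)
    (hP : ∀ τ ∈ uIcc s t, PP n M (V τ)) {v : ℝ × ℝ} (hv : |v.2| ≤ 1)
    (hB : ∀ τ ∈ uIcc s t, en (wt n 1) (fun j => ⇑(sd1 (V τ j)))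
      + en (fun _ => 1) (fun j => ⇑(V τ j)) ≤ B) :
    en (wt n 1) (fun j => ⇑(dif v (V t j))) ≤ Real.exp ((K + n/ε + 1) * |t - s|) *
      (en (wt n 1) (fun j => ⇑(dif v (V s j))) + (v.2^2 * Cs ε n K K2 C * B / ε^4) * |t - s|) := by
  have hφ := wt_Wt n zero_le_one
  have hav : Co Ka K (fun y => a (y + v.2)) := by
    refine ⟨hc.co.cd.comp (contDiff_id.add contDiff_const), fun y => hc.co.bd _, fun y => ?_⟩
    rw [deriv_comp_add_const]; exact hc.co.der _
  have hCs : 0 ≤ Cs ε n K K2 C := by unfold Cs; positivity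
  have hE : Evo ε 1 (v.2^2 * Cs ε n K K2 C * B / ε^4) ((2 * 3^n + 2) * M) (wt n 1)
      (fun y => a (y + v.2)) (fun y => b (y + v.2)) (fun τ j => dif v (V τ j))
      (fun τ => src ε a b v (V τ)) (uIcc s t) := by
    refine ⟨?_, ?_, fun τ hτ => (src_bound hc hv (V τ)).1,
      fun τ hτ => (src_bound hc hv (V τ)).2.1, ?_, ?_, ?_, ?_⟩
    · intro j x
      simp only [dif_apply]
      exact (hV j _).sub (hV j _)
    · intro τ hτ j x
      rw [Aop_dif]
      simp only [dif_apply]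
      rw [deriv_fun_sub (hV j _ τ) (hV j _ τ)]
      linarith [heq τ hτ j x, heq τ hτ j (x + v)]
    · intro τ hτ
      have h1 := (src_bound (ε := ε) hc hv (V τ)).2.2
      have h2 := mul_le_mul_of_nonneg_left (hB τ hτ)
        (mul_nonneg (sq_nonneg v.2) hCs)
      have : 1 * ε^4 * (v.2^2 * Cs ε n K K2 C * B / ε^4) = v.2^2 * Cs ε n K K2 C * B := by
        field_simp
      rw [this]; exact h1.trans h2
    · intro τ hτ
      refine (en_dif_le n hv _).trans (mul_le_mul_of_nonneg_left ?_ (by positivity))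
      have := en_mono hφ one_Wt (C := 1) (fun y => by simpa using hφ.le1 y) (V τ)
      linarith [(hP τ hτ).l2]
    · intro τ hτ
      simp only [sd1_dif]
      exact (en_dif_le n hv _).trans (mul_le_mul_of_nonneg_left (PP.sd1 (hP τ hτ).d1) (by positivity))
    · intro τ hτ
      simp only [sd2_dif]
      exact (en_dif_le n hv _).trans (mul_le_mul_of_nonneg_left (PP.sd2 (hP τ hτ).d2) (by positivity))
  have := core hε one_pos hφ hav hE
  simpa only [mul_one] using this

lemma PP_prop {ε T Ka K K2 C : ℝ} {a b : ℝ → ℝ} {V : ℝ → Fin 3 → SchwartzMap (ℝ × ℝ) ℝ} {n : ℕ}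
    (hε : 0 < ε) (hT : 0 < T) (hc : Cf n Ka K K2 C a b)
    (hV : ∀ (j : Fin 3) (x : ℝ × ℝ), Differentiable ℝ (fun t => V t j x))
    (heq : ∀ t ∈ Icc 0 T, ∀ (j : Fin 3) (x : ℝ × ℝ),
      ε^2 * deriv (fun s => V s j x) t + Aop ε a b (fun i => ⇑(V t i)) j x = 0) :
    ∃ D, ∀ s ∈ Icc 0 T, ∀ t ∈ Icc 0 T, ∀ M M', (∀ τ ∈ uIcc s t, PP n M' (V τ)) →
      PP n M (V s) → PP n (D * M) (V t) := by
  set R := K + n/ε + 1 with hR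
  have hK : 0 ≤ K := (abs_nonneg _).trans (hc.co.der 0)
  have hKR : K ≤ R := by have : 0 ≤ n/ε := by positivity
                         linarith
  have hR0 : 0 ≤ R := hK.trans hKR
  set L := Real.exp (R * T) with hL
  have hL0 : 0 ≤ L := (Real.exp_pos _).le
  have hCs : 0 ≤ Cs ε n K K2 C := by unfold Cs; positivity
  set E := Cs ε n K K2 C * (2 * L) / ε^4 * T with hE
  have hE0 : 0 ≤ E := by positivity
  refine ⟨L * (1 + E), fun s hs t ht M M' hP hPs => ?_⟩
  have hM := hPs.nonneg
  have hsub : uIcc s t ⊆ Icc 0 T := by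
    rw [← uIcc_of_le hT.le] at hs ht ⊢; exact uIcc_subset_uIcc hs ht
  have hsub2 : ∀ τ ∈ uIcc s t, uIcc s τ ⊆ uIcc s t := fun τ hτ =>
    uIcc_subset_uIcc left_mem_uIcc hτ
  have habs : ∀ τ ∈ uIcc s t, |τ - s| ≤ T := fun τ hτ => by
    have := hsub hτ
    rw [abs_le]; constructor <;> linarith [this.1, this.2, hs.1, hs.2]
  have hex : ∀ τ ∈ uIcc s t, Real.exp (R * |τ - s|) ≤ L := fun τ hτ =>
    Real.exp_le_exp.2 (mul_le_mul_of_nonneg_left (habs τ hτ) hR0)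
  have hexK : ∀ τ ∈ uIcc s t, Real.exp (K * |τ - s|) ≤ L := fun τ hτ =>
    (Real.exp_le_exp.2 (mul_le_mul_of_nonneg_right hKR (abs_nonneg _))).trans (hex τ hτ)
  have g0 : ∀ τ ∈ uIcc s t, en (fun _ => 1) (fun j => ⇑(V τ j)) ≤ L * M := by
    intro τ hτ
    have := l2_est hε hc.co hV (fun σ hσ => heq σ (hsub (hsub2 τ hτ hσ)))
      (fun σ hσ => hP σ (hsub2 τ hτ hσ))
    exact this.trans (mul_le_mul (hexK τ hτ) hPs.l2 (en_nonneg one_Wt _) hL0)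
  have g1 : ∀ τ ∈ uIcc s t, ∀ h : ℝ, |h| ≤ 1 →
      en (wt n 1) (fun j => ⇑(dif (h, 0) (V τ j))) ≤ L * M * h^2 := by
    intro τ hτ h hh
    have := dif_est (v := (h, 0)) (B := M' + M') hε hc hV
      (fun σ hσ => heq σ (hsub (hsub2 τ hτ hσ)))
      (fun σ hσ => hP σ (hsub2 τ hτ hσ)) (by simp)
      (fun σ hσ => add_le_add (PP.sd1 (hP σ (hsub2 τ hτ hσ)).d1) (hP σ (hsub2 τ hτ hσ)).l2)
    simp only [ne_eq, OfNat.ofNat_ne_zero, not_false_eq_true, zero_pow, zero_mul, zero_div,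
      add_zero] at this
    refine this.trans ?_
    rw [mul_assoc]
    exact mul_le_mul (hex τ hτ) (hPs.d1 h hh) (en_nonneg (wt_Wt n zero_le_one) _) hL0
  have hLM : 0 ≤ L * M := mul_nonneg hL0 hM
  have hLE : L * M ≤ L * (1 + E) * M := by
    have : 0 ≤ L * M * E := by positivity
    linarith
  refine ⟨(g0 t right_mem_uIcc).trans hLE, fun h hh => (g1 t right_mem_uIcc h hh).trans
    (mul_le_mul_of_nonneg_right hLE (sq_nonneg _)), fun h hh => ?_⟩
  have := dif_est (v := (0, h)) (B := L * M + L * M) hε hc hV (fun σ hσ => heq σ (hsub hσ)) hP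
    hh (fun σ hσ => add_le_add (PP.sd1 (g1 σ hσ)) (g0 σ hσ))
  refine this.trans ?_
  have hz : 0 ≤ h^2 * Cs ε n K K2 C * (L * M + L * M) / ε^4 := by positivity
  calc _ ≤ L * (M * h^2 + h^2 * Cs ε n K K2 C * (L * M + L * M) / ε^4 * T) := by
        refine mul_le_mul (hex t right_mem_uIcc) (add_le_add (hPs.d2 h hh) ?_) ?_ hL0
        · exact mul_le_mul_of_nonneg_left (habs t right_mem_uIcc) hz
        · exact add_nonneg (en_nonneg (wt_Wt n zero_le_one) _) (mul_nonneg hz (abs_nonneg _))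
    _ = L * (1 + E) * M * h^2 := by rw [hE]; ring

lemma lip_of_deriv {f : ℝ → ℝ} (hf : Differentiable ℝ f) {K : ℝ} (hK : ∀ y, |deriv f y| ≤ K)
    (y h : ℝ) : |f (y + h) - f y| ≤ K * |h| := by
  have := convex_univ.norm_image_sub_le_of_norm_deriv_le (𝕜 := ℝ) (f := f) (C := K)
    (x := y) (y := y + h) (fun z _ => hf z) (fun z _ => hK z) (mem_univ _) (mem_univ _)
  simpa using this

lemma Cf_of {n : ℕ} {C : ℝ} {ub b : ℝ → ℝ}
    (hub : ContDiff ℝ (⊤ : ℕ∞) ub) (hubc : HasCompactSupport ub)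
    (hb : ContDiff ℝ (⊤ : ℕ∞) b)
    (hbp : ∀ y : ℝ, |b y| ≤ C * (1 + |y|)^n ∧ |deriv b y| ≤ C * (1 + |y|)^n) :
    ∃ Ka K2, Cf n Ka (⨆ y : ℝ, |deriv ub y|) K2 C ub b := by
  have h1 : ContDiff ℝ 1 ub := hub.of_le (by exact_mod_cast le_top)
  have hd : ContDiff ℝ 1 (deriv ub) := by
    have h2 : ContDiff ℝ (1 + 1) ub := contDiff_infty.1 hub 2
    exact (contDiff_succ_iff_deriv.1 h2).2.2
  obtain ⟨Ka, hKa⟩ := hubc.exists_bound_of_continuous h1.continuous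
  obtain ⟨K, hK⟩ := hubc.deriv.exists_bound_of_continuous hd.continuous
  obtain ⟨K2, hK2⟩ := hubc.deriv.deriv.exists_bound_of_continuous (hd.continuous_deriv le_rfl)
  have hs : ∀ y, |deriv ub y| ≤ ⨆ y : ℝ, |deriv ub y| := fun y =>
    le_ciSup (f := fun y => |deriv ub y|) ⟨K, by rintro _ ⟨z, rfl⟩; exact hK z⟩ y
  have hC : 0 ≤ C := by
    have := (abs_nonneg _).trans (hbp 0).1
    simpa using this
  refine ⟨Ka, K2, ⟨h1, hKa, hs⟩, lip_of_deriv (h1.differentiable one_ne_zero) hs,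
    lip_of_deriv (hd.differentiable one_ne_zero) hK2, hb.continuous, fun y h hh => ?_⟩
  have hbd : Differentiable ℝ b := hb.differentiable (by simp)
  have := (convex_segment y (y+h)).norm_image_sub_le_of_norm_deriv_le (𝕜 := ℝ) (f := b)
      (C := C * (2 + |y|)^n) (x := y) (y := y + h)
      (fun z _ => hbd z) ?_ (left_mem_segment _ _ _) (right_mem_segment _ _ _)
  · rw [mul_comm]; simpa using this
  · intro z hz
    refine ((hbp z).2).trans (mul_le_mul_of_nonneg_left
      (pow_le_pow_left₀ (by positivity) ?_ n) hC)
    rw [segment_eq_image'] at hz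
    obtain ⟨θ, hθ, rfl⟩ := hz
    simp only [add_sub_cancel_left, smul_eq_mul]
    have h3 : |θ * h| ≤ 1 := by
      rw [abs_mul, abs_of_nonneg hθ.1]
      exact mul_le_one₀ hθ.2 (abs_nonneg _) hh
    linarith [abs_add_le y (θ * h)]

end helpers

/-- Energy estimate for the linear system
`ε²∂ₜV + A(x₂,εD)V = 0`: for `t ∈ [0,T]`,
`‖V(t)‖_{L²} ≤ e^{‖ū₁′‖_{L^∞} t} ‖V(0)‖_{L²}`, uniformly in `ε`. -/
theorem linear_energy_estimate
    (ε T : ℝ) (hε : 0 < ε) (hT : 0 < T)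
    (ub : ℝ → ℝ) (hub : ContDiff ℝ (⊤ : ℕ∞) ub) (hubc : HasCompactSupport ub)
    (b : ℝ → ℝ) (hb : ContDiff ℝ (⊤ : ℕ∞) b)
    (hbpoly : ∃ (C : ℝ) (n : ℕ), ∀ y : ℝ,
      |b y| ≤ C * (1 + |y|)^n ∧ |deriv b y| ≤ C * (1 + |y|)^n)
    (V : ℝ → Fin 3 → SchwartzMap (ℝ × ℝ) ℝ)
    (hVdiff : ∀ (j : Fin 3) (x : ℝ × ℝ), Differentiable ℝ (fun t => V t j x))
    (hVeq : ∀ t ∈ Set.Icc (0:ℝ) T, ∀ (j : Fin 3) (x : ℝ × ℝ),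
      ε^2 * deriv (fun s => V s j x) t + Aop ε ub b (fun i => ⇑(V t i)) j x = 0) :
    ∀ t ∈ Set.Icc (0:ℝ) T,
      L2normV (fun j => ⇑(V t j))
        ≤ Real.exp ((⨆ y : ℝ, |deriv ub y|) * t) * L2normV (fun j => ⇑(V 0 j)) := by
  obtain ⟨C, n, hbp⟩ := hbpoly
  obtain ⟨Ka, K2, hc⟩ := Cf_of hub hubc hb hbp
  obtain ⟨D, hD⟩ := PP_prop hε hT hc hVdiff hVeq
  obtain ⟨M, hM⟩ := baire_bounded (T := T) (C := D) (P := fun M τ => PP n M (V τ))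
    (fun M M' τ h hP => hP.mono h) (fun τ => PP_fin n (V τ)) (fun M => PP_closed n M hVdiff) hD
  intro t ht
  have hsub : Set.uIcc 0 t ⊆ Set.Icc 0 T := by
    rw [Set.uIcc_of_le ht.1]; exact Set.Icc_subset_Icc_right ht.2
  have key := l2_est (s := 0) (t := t) hε hc.co hVdiff (fun τ hτ => hVeq τ (hsub hτ))
    (fun τ hτ => hM τ (hsub hτ))
  simp only [en, one_mul, sub_zero, abs_of_nonneg ht.1] at key
  set K := ⨆ y : ℝ, |deriv ub y| with hKdef
  have hK : 0 ≤ K := (abs_nonneg _).trans (hc.co.der 0)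
  have h1 : 1 ≤ Real.exp (K * t) := Real.one_le_exp (mul_nonneg hK ht.1)
  unfold L2normV
  rw [← Real.sqrt_sq (Real.exp_pos (K * t)).le, ← Real.sqrt_mul (sq_nonneg _)]
  refine Real.sqrt_le_sqrt (key.trans (mul_le_mul_of_nonneg_right ?_ ?_))
  · nlinarith
  · exact MeasureTheory.integral_nonneg fun x => Finset.sum_nonneg fun _ _ => sq_nonneg _

end
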